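/- arXiv:1207.4856 — 2 statements merged into one kernel-verified Lean document; each statement's English description precedes it below -/
import Mathlib

section
/- For a Nakayama algebra, an embedding M → P of an indecomposable non-projective torsionless module M into a minimal projective module P is a minimal left Λ-approximation by projective modules. -/
universe u

variable (Λ : Type u) [Ring Λ]

section BasicDefs

variable (M : Type u) [AddCommGroup M] [Module Λ M]

/-- A module is uniserial if its submodules are linearly ordered by inclusion. -/
def IsUniserialMod : Prop := ∀ N N' : Submodule Λ M, N ≤ N' ∨ N' ≤ N

/-- A module is indecomposable if it is nonzero and admits no nontrivial direct sum
decomposition. -/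
def IsIndecomposableMod : Prop :=
  Nontrivial M ∧ ∀ N N' : Submodule Λ M, IsCompl N N' → N = ⊥ ∨ N' = ⊥

/-- The radical of a module: the intersection of all maximal submodules. -/
def modRadical : Submodule Λ M := sInf {N : Submodule Λ M | IsCoatom N}

/-- The socle of a module: the sum of all simple submodules. -/
def modSocle : Submodule Λ M := sSup {N : Submodule Λ M | IsAtom N}

/-- `HasLength Λ M n` : the module `M` has a composition series of length `n`. -/
def HasLength (n : ℕ) : Prop :=
  ∃ c : Fin (n + 1) → Submodule Λ M,
    c 0 = ⊥ ∧ c (Fin.last n) = ⊤ ∧ ∀ i : Fin n, c i.castSucc ⋖ c i.succ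

end BasicDefs

/-- A Nakayama algebra: an artinian ring all of whose finite-length indecomposable
(left) modules are uniserial. -/
class IsNakayama : Prop where
  artinian : IsArtinianRing Λ
  serial : ∀ (M : Type u) [AddCommGroup M] [Module Λ M],
    (∃ n, HasLength Λ M n) → IsIndecomposableMod Λ M → IsUniserialMod Λ M

/-- `Λ` has no simple projective module. -/
def NoSimpleProjectives : Prop :=
  ∀ (M : Type u) [AddCommGroup M] [Module Λ M], IsSimpleModule Λ M → ¬ Module.Projective Λ M

/-- `Λ` is connected: no nontrivial central idempotents. -/
def IsConnectedAlg : Prop :=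
  ∀ e : Λ, IsIdempotentElem e → (∀ x : Λ, e * x = x * e) → e = 0 ∨ e = 1

section Covers

variable {Λ}
variable {P M : Type u} [AddCommGroup P] [Module Λ P] [AddCommGroup M] [Module Λ M]

/-- `p : P → M` is a projective cover: `P` projective, `p` surjective with superfluous
kernel. -/
structure IsProjCover (p : P →ₗ[Λ] M) : Prop where
  projective : Module.Projective Λ P
  surjective : Function.Surjective p
  superfluous : LinearMap.ker p ≤ modRadical Λ P

end Covers

/-- `S` is (isomorphic to) the top `M/rad M` of `M`, and is simple. -/
def IsTopOf (S M : Type u) [AddCommGroup S] [Module Λ S] [AddCommGroup M] [Module Λ M] :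
    Prop :=
  IsSimpleModule Λ S ∧
    ∃ p : M →ₗ[Λ] S, Function.Surjective p ∧ LinearMap.ker p = modRadical Λ M

/-- `S` is (isomorphic to) the socle of `M`. -/
def IsSocleOf (S M : Type u) [AddCommGroup S] [Module Λ S] [AddCommGroup M] [Module Λ M] :
    Prop :=
  ∃ i : S →ₗ[Λ] M, Function.Injective i ∧ LinearMap.range i = modSocle Λ M

/-- `IsTauOf Λ T S` : `T` is the Auslander–Reiten translate `τ S` of the simple module `S`;
for a Nakayama algebra without simple projectives this means there is a length-2 module
with top `S` and socle `T`. -/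
def IsTauOf (T S : Type u) [AddCommGroup T] [Module Λ T] [AddCommGroup S] [Module Λ S] :
    Prop :=
  IsSimpleModule Λ S ∧ IsSimpleModule Λ T ∧
    ∃ L : ModuleCat.{u} Λ, HasLength Λ L 2 ∧ IsTopOf Λ S L ∧ IsSocleOf Λ T L

/-- `GammaRel Λ S T` : `T = γ S = τ soc P(S)` in the resolution quiver. -/
def GammaRel (S T : Type u) [AddCommGroup S] [Module Λ S] [AddCommGroup T] [Module Λ T] :
    Prop :=
  IsSimpleModule Λ S ∧
    ∃ (P : ModuleCat.{u} Λ) (p : P →ₗ[Λ] S), IsProjCover p ∧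
      ∃ V : ModuleCat.{u} Λ, IsSimpleModule Λ V ∧ IsSocleOf Λ V P ∧ IsTauOf Λ T V

/-- A simple module is black if its projective dimension is at least 2, i.e. the kernel of
its projective cover is not projective. -/
def IsBlackSimple (S : Type u) [AddCommGroup S] [Module Λ S] : Prop :=
  IsSimpleModule Λ S ∧
    ∀ (P : ModuleCat.{u} Λ) (p : P →ₗ[Λ] S), IsProjCover p →
      ¬ Module.Projective Λ (LinearMap.ker p)

/-- A simple module is red if it has projective dimension exactly 1, i.e. the kernel of its
projective cover is projective. -/
def IsRedSimple (S : Type u) [AddCommGroup S] [Module Λ S] : Prop :=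
  IsSimpleModule Λ S ∧
    ∃ (P : ModuleCat.{u} Λ) (p : P →ₗ[Λ] S), IsProjCover p ∧
      Module.Projective Λ (LinearMap.ker p)

/-- A simple module is cyclically black if it lies on a cycle of the resolution quiver all
of whose vertices are black. -/
def IsCyclicallyBlack (S : Type u) [AddCommGroup S] [Module Λ S] : Prop :=
  ∃ (n : ℕ) (C : ℕ → ModuleCat.{u} Λ), 0 < n ∧
    Nonempty ((C 0 : Type u) ≃ₗ[Λ] S) ∧ Nonempty ((C n : Type u) ≃ₗ[Λ] S) ∧
    (∀ i < n, GammaRel Λ (C i) (C (i + 1))) ∧ ∀ i ≤ n, IsBlackSimple Λ (C i)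

/-- An indecomposable projective module is minimal projective if its radical is not
projective. -/
def IsMinimalProjective (P : Type u) [AddCommGroup P] [Module Λ P] : Prop :=
  Module.Projective Λ P ∧ IsIndecomposableMod Λ P ∧
    ¬ Module.Projective Λ (modRadical Λ P)

/-- `M` is Gorenstein projective: it is an image in a complete projective resolution, i.e.
an exact complex of projectives which stays exact after applying `Hom(-, Λ)`. -/
def IsGorensteinProjective (M : Type u) [AddCommGroup M] [Module Λ M] : Prop :=
  ∃ (P : ℤ → ModuleCat.{u} Λ) (d : ∀ i, P (i + 1) →ₗ[Λ] P i),
    (∀ i, Module.Projective Λ (P i)) ∧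
    (∀ i, Function.Exact (d (i + 1)) (d i)) ∧
    (∀ (i : ℤ) (φ : P (i + 1) →ₗ[Λ] Λ), φ.comp (d (i + 1)) = 0 →
      ∃ ψ : P i →ₗ[Λ] Λ, ψ.comp (d i) = φ) ∧
    Nonempty (M ≃ₗ[Λ] LinearMap.range (d 0))

/-- `M` has a finite projective resolution. -/
def HasFinitePD (M : Type u) [AddCommGroup M] [Module Λ M] : Prop :=
  ∃ (n : ℕ) (P : ℕ → ModuleCat.{u} Λ) (d : ∀ i, P (i + 1) →ₗ[Λ] P i)
      (ε : P 0 →ₗ[Λ] M),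
    (∀ i, Module.Projective Λ (P i)) ∧ Function.Surjective ε ∧
    Function.Exact (d 0) ε ∧ (∀ i, Function.Exact (d (i + 1)) (d i)) ∧
    ∀ i, n < i → Subsingleton (P i)

/-- `M` has injective dimension at most `n` (over the ring `Λ`). -/
def InjDimLE (M : Type u) [AddCommGroup M] [Module Λ M] (n : ℕ) : Prop :=
  ∃ (I : ℕ → ModuleCat.{u} Λ) (η : M →ₗ[Λ] I 0) (d : ∀ i, I i →ₗ[Λ] I (i + 1)),
    (∀ i, Module.Injective Λ (I i)) ∧ Function.Injective η ∧
    Function.Exact η (d 0) ∧ (∀ i, Function.Exact (d i) (d (i + 1))) ∧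
    ∀ i, n < i → Subsingleton (I i)

/-- `Λ` is a Gorenstein algebra: finite injective dimension as a left and right module
over itself. -/
def IsGorensteinAlg : Prop :=
  (∃ n, InjDimLE Λ Λ n) ∧ ∃ n, InjDimLE Λᵐᵒᵖ Λ n

/-- Every cycle of the resolution quiver consists of black vertices. -/
def AllCyclesBlack : Prop :=
  ∀ (n : ℕ) (C : ℕ → ModuleCat.{u} Λ), 0 < n →
    (∀ i < n, GammaRel Λ (C i) (C (i + 1))) →
    Nonempty ((C n : Type u) ≃ₗ[Λ] (C 0 : Type u)) →
    ∀ i ≤ n, IsBlackSimple Λ (C i)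

/-- Every cycle of the resolution quiver contains a red vertex. -/
def EveryCycleHasRed : Prop :=
  ∀ (n : ℕ) (C : ℕ → ModuleCat.{u} Λ), 0 < n →
    (∀ i < n, GammaRel Λ (C i) (C (i + 1))) →
    Nonempty ((C n : Type u) ≃ₗ[Λ] (C 0 : Type u)) →
    ∃ i ≤ n, IsRedSimple Λ (C i)

/-- `Λ` is CM-free: every finite-length Gorenstein projective module is projective. -/
def IsCMFree : Prop :=
  ∀ (M : Type u) [AddCommGroup M] [Module Λ M],
    (∃ n, HasLength Λ M n) → IsGorensteinProjective Λ M → Module.Projective Λ M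

/-- `Λ` has exactly `s` isomorphism classes of simple modules. -/
def SimpleCount (s : ℕ) : Prop :=
  ∃ F : Fin s → ModuleCat.{u} Λ,
    (∀ i, IsSimpleModule Λ (F i)) ∧
    (∀ i j, i ≠ j → IsEmpty ((F i : Type u) ≃ₗ[Λ] (F j : Type u))) ∧
    ∀ (S : Type u) [AddCommGroup S] [Module Λ S], IsSimpleModule Λ S →
      ∃ i, Nonempty (S ≃ₗ[Λ] (F i : Type u))

/-- Every (finite length) indecomposable projective module has length `> s`;
this is the condition `p > s`. -/
def MinProjLengthGT (s : ℕ) : Prop :=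
  ∀ (P : Type u) [AddCommGroup P] [Module Λ P],
    Module.Projective Λ P → IsIndecomposableMod Λ P →
      ∀ n, HasLength Λ P n → s < n

/-- An elementary Gorenstein projective module: nonzero, Gorenstein projective,
non-projective, and no proper nonzero factor module is Gorenstein projective. -/
def IsElementary (E : Type u) [AddCommGroup E] [Module Λ E] : Prop :=
  Nontrivial E ∧ (∃ n, HasLength Λ E n) ∧ IsGorensteinProjective Λ E ∧
    ¬ Module.Projective Λ E ∧
    ∀ N : Submodule Λ E, N ≠ ⊥ → N ≠ ⊤ → ¬ IsGorensteinProjective Λ (E ⧸ N)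

/-- `m` is the multiplicity of the simple module `S` as a composition factor of `M`. -/
def MultiplicityOf (S M : Type u) [AddCommGroup S] [Module Λ S] [AddCommGroup M]
    [Module Λ M] (m : ℕ) : Prop :=
  ∃ (n : ℕ) (c : Fin (n + 1) → Submodule Λ M),
    c 0 = ⊥ ∧ c (Fin.last n) = ⊤ ∧ (∀ i : Fin n, c i.castSucc ⋖ c i.succ) ∧
    m = Nat.card {i : Fin n //
      Nonempty ((↥(c i.succ) ⧸ (c i.castSucc).comap (c i.succ).subtype) ≃ₗ[Λ] S)}

/-- From `S`, the cycles of the resolution quiver can be reached (in a black-cycle vertex)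
in `m` steps. -/
def ReachesBlackIn (S : Type u) [AddCommGroup S] [Module Λ S] (m : ℕ) : Prop :=
  ∃ C : ℕ → ModuleCat.{u} Λ, Nonempty ((C 0 : Type u) ≃ₗ[Λ] S) ∧
    (∀ i < m, GammaRel Λ (C i) (C (i + 1))) ∧ IsCyclicallyBlack Λ (C m)

/-- `d` is the maximal distance of a vertex of the resolution quiver to the black cycles. -/
def MaxDistToBlack (d : ℕ) : Prop :=
  (∀ (S : Type u) [AddCommGroup S] [Module Λ S], IsSimpleModule Λ S →
      ∃ m ≤ d, ReachesBlackIn Λ S m) ∧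
  ∃ S : ModuleCat.{u} Λ, IsSimpleModule Λ S ∧ ∀ m < d, ¬ ReachesBlackIn Λ (S : Type u) m

namespace NakHelp

section
variable {Λ}

theorem artin [h : IsNakayama Λ] : IsArtinianRing Λ := h.artinian

theorem hasLength_of_finite [IsNakayama Λ] (X : Type u) [AddCommGroup X] [Module Λ X]
    [Module.Finite Λ X] : ∃ n, HasLength Λ X n := by
  have : IsArtinianRing Λ := artin
  have : IsNoetherianRing Λ := inferInstance
  obtain ⟨s, h1, h2⟩ := exists_compositionSeries_of_isNoetherian_isArtinian Λ X
  exact ⟨s.length, s.toFun, h1, h2, s.step⟩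

theorem uniserial [IsNakayama Λ] {X : Type u} [AddCommGroup X] [Module Λ X]
    [Module.Finite Λ X] (h : IsIndecomposableMod Λ X) : IsUniserialMod Λ X :=
  IsNakayama.serial X (hasLength_of_finite X) h

/-- Induction along direct sum decompositions. -/
theorem decomp_induction [IsNakayama Λ]
    (C : ∀ (X : Type u) [AddCommGroup X] [Module Λ X], Prop)
    (h0 : ∀ (X : Type u) [AddCommGroup X] [Module Λ X], Subsingleton X → C X)
    (h1 : ∀ (X : Type u) [AddCommGroup X] [Module Λ X], Module.Finite Λ X →
      IsIndecomposableMod Λ X → C X)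
    (h2 : ∀ (X : Type u) [AddCommGroup X] [Module Λ X] (A B : Submodule Λ X),
      IsCompl A B → C A → C B → C X) :
    ∀ (X : Type u) [AddCommGroup X] [Module Λ X], Module.Finite Λ X → C X := by
  have : IsArtinianRing Λ := artin
  have : IsNoetherianRing Λ := inferInstance
  have key : ∀ (l : ℕ∞) (X : Type u) [AddCommGroup X] [Module Λ X], Module.Finite Λ X →
      Module.length Λ X = l → C X := by
    intro l
    induction l using WellFoundedLT.induction with
    | ind l ih =>
      intro X _ _ hX hl
      by_cases hs : Subsingleton X
      · exact h0 X hs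
      by_cases hi : IsIndecomposableMod Λ X
      · exact h1 X hX hi
      rw [not_subsingleton_iff_nontrivial] at hs
      simp only [IsIndecomposableMod, not_and, not_forall] at hi
      obtain ⟨A, B, hAB, hne⟩ := hi hs
      rw [not_or] at hne
      have hA : A ≠ ⊤ := by
        rintro rfl
        exact hne.2 (top_disjoint.1 hAB.disjoint)
      have hB : B ≠ ⊤ := by
        rintro rfl
        exact hne.1 (disjoint_top.1 hAB.disjoint)
      exact h2 X A B hAB
        (ih _ (hl ▸ Submodule.length_lt hA) A inferInstance rfl)
        (ih _ (hl ▸ Submodule.length_lt hB) B inferInstance rfl)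
  intro X _ _ hX
  exact key _ X hX rfl

theorem proj_compl {X : Type u} [AddCommGroup X] [Module Λ X] {A B : Submodule Λ X}
    (h : IsCompl A B) (hX : Module.Projective Λ X) : Module.Projective Λ A :=
  Module.Projective.of_split A.subtype (A.projectionOnto B h)
    (Submodule.projectionOnto_comp_subtype h)

theorem surj_of_simple {Q S : Type u} [AddCommGroup Q] [Module Λ Q]
    [AddCommGroup S] [Module Λ S] [IsSimpleModule Λ S] (q : Q →ₗ[Λ] S) (hq : q ≠ 0) :
    Function.Surjective q := by
  rw [← LinearMap.range_eq_top]
  rcases eq_bot_or_eq_top (LinearMap.range q) with h | h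
  · exact absurd (LinearMap.range_eq_bot.1 h) hq
  · exact h

theorem exists_cover [IsNakayama Λ] (S : Type u) [AddCommGroup S] [Module Λ S]
    [IsSimpleModule Λ S] :
    ∃ (Q : ModuleCat.{u} Λ) (q : Q →ₗ[Λ] S), Module.Finite Λ Q ∧ IsIndecomposableMod Λ Q ∧
      Module.Projective Λ Q ∧ Function.Surjective q := by
  have key := decomp_induction (Λ := Λ) (fun X _ _ => Module.Projective Λ X →
    ∀ g : X →ₗ[Λ] S, g ≠ 0 → ∃ (Q : ModuleCat.{u} Λ) (q : Q →ₗ[Λ] S), Module.Finite Λ Q ∧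
      IsIndecomposableMod Λ Q ∧ Module.Projective Λ Q ∧ Function.Surjective q)
    (by
      intro X _ _ hs _ g hg
      exact absurd (LinearMap.ext fun x => by rw [Subsingleton.elim x 0, map_zero, map_zero]) hg)
    (by
      intro X _ _ hF hi hp g hg
      exact ⟨ModuleCat.of Λ X, g, hF, hi, hp, surj_of_simple g hg⟩)
    (by
      intro X _ _ A B hAB hA hB hp g hg
      by_cases h1 : g.comp A.subtype = 0
      · by_cases h2 : g.comp B.subtype = 0
        · exfalso
          apply hg
          ext x
          obtain ⟨a, ha, b, hb, rfl⟩ := Submodule.mem_sup.1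
            (show x ∈ A ⊔ B by rw [hAB.sup_eq_top]; trivial)
          have e1 := LinearMap.congr_fun h1 ⟨a, ha⟩
          have e2 := LinearMap.congr_fun h2 ⟨b, hb⟩
          simp at e1 e2
          simp [e1, e2]
        · exact hB (proj_compl hAB.symm hp) _ h2
      · exact hA (proj_compl hAB hp) _ h1)
    Λ inferInstance inferInstance
  have : Nontrivial S := IsSimpleModule.nontrivial Λ S
  obtain ⟨s, hs⟩ := exists_ne (0 : S)
  refine key (LinearMap.toSpanSingleton Λ S s) ?_
  intro h
  apply hs
  simpa using LinearMap.congr_fun h 1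

theorem lift_surj {A B S : Type u} [AddCommGroup A] [Module Λ A] [AddCommGroup B] [Module Λ B]
    [AddCommGroup S] [Module Λ S] [Nontrivial S] [Module.Projective Λ A]
    (hB : IsUniserialMod Λ B) (a : A →ₗ[Λ] S) (ha : Function.Surjective a)
    (b : B →ₗ[Λ] S) (hb : Function.Surjective b) :
    ∃ l : A →ₗ[Λ] B, Function.Surjective l := by
  obtain ⟨l, hl⟩ := Module.projective_lifting_property b a hb
  refine ⟨l, ?_⟩
  have hl' : ∀ x, b (l x) = a x := fun x => LinearMap.congr_fun hl x
  rcases hB (LinearMap.range l) (LinearMap.ker b) with h | h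
  · exfalso
    obtain ⟨s, hs⟩ := exists_ne (0 : S)
    obtain ⟨x, rfl⟩ := ha s
    apply hs
    rw [← hl']
    exact h ⟨x, rfl⟩
  · intro y
    obtain ⟨x, hx⟩ := ha (b y)
    have : y - l x ∈ LinearMap.ker b := by
      rw [LinearMap.mem_ker, map_sub, hl', hx, sub_self]
    obtain ⟨z, hz⟩ := h this
    exact ⟨z + x, by rw [map_add, hz, sub_add_cancel]⟩

theorem inj_of_indec {A B : Type u} [AddCommGroup A] [Module Λ A] [AddCommGroup B] [Module Λ B]
    [Nontrivial B] [Module.Projective Λ B]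
    (hA : IsIndecomposableMod Λ A) (l : A →ₗ[Λ] B) (hl : Function.Surjective l) :
    Function.Injective l := by
  obtain ⟨s, hs⟩ := Module.projective_lifting_property l LinearMap.id hl
  have hs' : ∀ y, l (s y) = y := fun y => LinearMap.congr_fun hs y
  have hc : IsCompl (LinearMap.ker l) (LinearMap.range s) := by
    constructor
    · rw [Submodule.disjoint_def]
      rintro _ h ⟨y, rfl⟩
      rw [LinearMap.mem_ker, hs'] at h
      rw [h, map_zero]
    · rw [codisjoint_iff, eq_top_iff]
      intro x _
      refine Submodule.mem_sup.2 ⟨x - s (l x), ?_, s (l x), ⟨_, rfl⟩, sub_add_cancel _ _⟩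
      rw [LinearMap.mem_ker, map_sub, hs', sub_self]
  rcases hA.2 _ _ hc with h | h
  · exact LinearMap.ker_eq_bot.1 h
  · exfalso
    obtain ⟨y, hy⟩ := exists_ne (0 : B)
    apply hy
    rw [← hs' y, LinearMap.range_eq_bot.1 h]
    simp

theorem uniserial_sub {A : Type u} [AddCommGroup A] [Module Λ A] (hA : IsUniserialMod Λ A)
    (D : Submodule Λ A) : IsUniserialMod Λ D := by
  intro N N'
  have := hA (N.map D.subtype) (N'.map D.subtype)
  simpa [Submodule.map_le_map_iff_of_injective D.injective_subtype] using this

theorem indec_of_uniserial {A : Type u} [AddCommGroup A] [Module Λ A] [Nontrivial A]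
    (hA : IsUniserialMod Λ A) : IsIndecomposableMod Λ A := by
  refine ⟨inferInstance, fun N N' h => ?_⟩
  rcases hA N N' with h' | h'
  · exact Or.inl (h.disjoint.eq_bot_of_le h')
  · exact Or.inr (h.symm.disjoint.eq_bot_of_le h')

theorem key {A U Q : Type u} [AddCommGroup A] [Module Λ A] [AddCommGroup U] [Module Λ U]
    [AddCommGroup Q] [Module Λ Q] [Nontrivial Q] [Module.Projective Λ Q]
    (hA : IsUniserialMod Λ A) (p : A →ₗ[Λ] U) (hp : Function.Surjective p)
    (i : Q →ₗ[Λ] U) (hi : Function.Injective i) :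
    Module.Projective Λ ((LinearMap.range i).comap p) ∧ (LinearMap.range i).comap p ≠ ⊥ ∧
      Function.Injective p := by
  set D := (LinearMap.range i).comap p with hD
  let e := LinearEquiv.ofInjective i hi
  let r : D →ₗ[Λ] LinearMap.range i := p.restrict (fun x hx => hx)
  have hr : Function.Surjective r := by
    rintro ⟨y, hy⟩
    obtain ⟨x, rfl⟩ := hp y
    exact ⟨⟨x, hy⟩, rfl⟩
  let t : D →ₗ[Λ] Q := e.symm.toLinearMap.comp r
  have ht : Function.Surjective t := e.symm.surjective.comp hr
  have : Nontrivial D := ht.nontrivial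
  have hti : Function.Injective t :=
    inj_of_indec (indec_of_uniserial (uniserial_sub hA D)) t ht
  refine ⟨Module.Projective.of_equiv (LinearEquiv.ofBijective t ⟨hti, ht⟩).symm,
    (Submodule.nontrivial_iff_ne_bot).1 inferInstance, ?_⟩
  rw [← LinearMap.ker_eq_bot, LinearMap.ker_eq_bot']
  intro x hx
  have hxD : x ∈ D := by
    rw [hD, Submodule.mem_comap, hx]
    exact zero_mem _
  have h0 : r ⟨x, hxD⟩ = 0 := Subtype.ext hx
  have h1 : t ⟨x, hxD⟩ = 0 := by
    simp [t, h0]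
  have h2 : (⟨x, hxD⟩ : D) = 0 := hti (by rw [h1, map_zero])
  exact congrArg Subtype.val h2

theorem exists_coatom {P : Type u} [AddCommGroup P] [Module Λ P]
    (hP : IsMinimalProjective Λ P) : ∃ N : Submodule Λ P, IsCoatom N := by
  by_contra h
  push Not at h
  apply hP.2.2
  have h1 : modRadical Λ P = ⊤ := by
    rw [modRadical, sInf_eq_top]
    intro N hN
    exact absurd hN (h N)
  have := hP.1
  rw [h1]
  exact Module.Projective.of_equiv Submodule.topEquiv.symm

theorem minimal_finite [IsNakayama Λ] {P : Type u} [AddCommGroup P] [Module Λ P]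
    (hP : IsMinimalProjective Λ P) : Module.Finite Λ P := by
  obtain ⟨N, hN⟩ := exists_coatom hP
  have : IsSimpleModule Λ (P ⧸ N) := isSimpleModule_iff_isCoatom.2 hN
  have : Nontrivial (P ⧸ N) := IsSimpleModule.nontrivial Λ _
  obtain ⟨Q, q, hQ, hQi, hQp, hq⟩ := exists_cover (Λ := Λ) (P ⧸ N)
  have := hP.1
  have := hQi.1
  obtain ⟨l, hl⟩ := lift_surj (uniserial hQi) N.mkQ N.mkQ_surjective q hq
  have hli := inj_of_indec hP.2.1 l hl
  exact Module.Finite.equiv (LinearEquiv.ofBijective l ⟨hli, hl⟩).symm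

theorem no_proj_sub [IsNakayama Λ] {P : Type u} [AddCommGroup P] [Module Λ P]
    (hP : IsMinimalProjective Λ P) (D : Submodule Λ P) (hD : Module.Projective Λ D)
    (hb : D ≠ ⊥) : D = ⊤ := by
  by_contra hne
  have : IsArtinianRing Λ := artin
  have : IsNoetherianRing Λ := inferInstance
  have := minimal_finite hP
  have hu := uniserial hP.2.1
  obtain ⟨N, hN⟩ := exists_coatom hP
  have hle : ∀ E : Submodule Λ P, E ≠ ⊤ → E ≤ N := by
    intro E hE
    rcases hu E N with h | h
    · exact h
    · rcases h.lt_or_eq with h' | h'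
      · exact absurd (hN.2 _ h') hE
      · exact h'.ge
  have hrad : modRadical Λ P = N := by
    refine le_antisymm (sInf_le (show N ∈ {E : Submodule Λ P | IsCoatom E} from hN)) ?_
    apply le_sInf
    intro E hE
    have hE' : IsCoatom E := hE
    have h1 := hle E hE'.1
    rcases h1.lt_or_eq with h' | h'
    · exact absurd (hE'.2 _ h') hN.1
    · exact h'.ge
  apply hP.2.2
  rw [hrad]
  have hDN := hle D hne
  have : Nontrivial D := (Submodule.nontrivial_iff_ne_bot).2 hb
  let i := Submodule.inclusion hDN
  have hi : Function.Injective i := Submodule.inclusion_injective hDN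
  have : Nontrivial N := hi.nontrivial
  have huN := uniserial_sub hu N
  obtain ⟨K, hK, -⟩ := (eq_top_or_exists_le_coatom (⊥ : Submodule Λ N)).resolve_left bot_ne_top
  have : IsSimpleModule Λ (N ⧸ K) := isSimpleModule_iff_isCoatom.2 hK
  have : Nontrivial (N ⧸ K) := IsSimpleModule.nontrivial Λ _
  obtain ⟨Q, q, hQ, hQi, hQp, hq⟩ := exists_cover (Λ := Λ) (N ⧸ K)
  obtain ⟨l, hl⟩ := lift_surj huN q hq K.mkQ K.mkQ_surjective
  have hli := (key (uniserial hQi) l hl i hi).2.2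
  exact Module.Projective.of_equiv (LinearEquiv.ofBijective l ⟨hli, hl⟩)

/-- A nonzero uniserial submodule of `X` embeds into an indecomposable summand. -/
theorem exists_summand [IsNakayama Λ] {Q : Type u} [AddCommGroup Q] [Module Λ Q] [Nontrivial Q]
    (hQ : IsUniserialMod Λ Q) :
    ∀ (X : Type u) [AddCommGroup X] [Module Λ X], Module.Finite Λ X →
      ∀ j : Q →ₗ[Λ] X, Function.Injective j →
      ∃ (U : ModuleCat.{u} Λ) (p : X →ₗ[Λ] U), Module.Finite Λ U ∧ IsIndecomposableMod Λ U ∧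
        Function.Surjective p ∧ Function.Injective (p.comp j) := by
  apply decomp_induction (Λ := Λ)
  · intro X _ _ hs j hj
    have := hj.nontrivial
    exact absurd hs (not_subsingleton X)
  · intro X _ _ hF hi j hj
    exact ⟨ModuleCat.of Λ X, LinearMap.id, hF, hi, Function.surjective_id, hj⟩
  · intro X _ _ A B hAB hA hB j hj
    let a := (A.projectionOnto B hAB).comp j
    let b := (B.projectionOnto A hAB.symm).comp j
    have hab : LinearMap.ker a ⊓ LinearMap.ker b = ⊥ := by
      rw [eq_bot_iff]
      rintro x ⟨h1, h2⟩
      have h1' : j x ∈ B := (Submodule.projectionOnto_apply_eq_zero_iff hAB).1 h1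
      have h2' : j x ∈ A := (Submodule.projectionOnto_apply_eq_zero_iff hAB.symm).1 h2
      have h3 : j x = 0 := (Submodule.disjoint_def.1 hAB.disjoint) _ h2' h1'
      exact hj (by rw [h3, map_zero])
    rcases hQ (LinearMap.ker a) (LinearMap.ker b) with h | h
    · rw [inf_eq_left.2 h] at hab
      obtain ⟨U, p, h1, h2, h3, h4⟩ := hA a (LinearMap.ker_eq_bot.1 hab)
      exact ⟨U, p.comp (A.projectionOnto B hAB), h1, h2,
        h3.comp (Submodule.projectionOnto_surjective hAB), h4⟩
    · rw [inf_eq_right.2 h] at hab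
      obtain ⟨U, p, h1, h2, h3, h4⟩ := hB b (LinearMap.ker_eq_bot.1 hab)
      exact ⟨U, p.comp (B.projectionOnto A hAB.symm), h1, h2,
        h3.comp (Submodule.projectionOnto_surjective hAB.symm), h4⟩

theorem extend_indec [IsNakayama Λ] {M P Q : Type u} [AddCommGroup M] [Module Λ M]
    [AddCommGroup P] [Module Λ P] [AddCommGroup Q] [Module Λ Q]
    (f : M →ₗ[Λ] P) (hf : Function.Injective f) (hP : IsMinimalProjective Λ P)
    (hQf : Module.Finite Λ Q) (hQi : IsIndecomposableMod Λ Q) (hQp : Module.Projective Λ Q)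
    (g : M →ₗ[Λ] Q) : ∃ h : P →ₗ[Λ] Q, h.comp f = g := by
  have := minimal_finite hP
  have := hQi.1
  let R : Submodule Λ (P × Q) := LinearMap.range (f.prod (-g))
  let iP : P →ₗ[Λ] (P × Q) ⧸ R := R.mkQ.comp (LinearMap.inl Λ P Q)
  let iQ : Q →ₗ[Λ] (P × Q) ⧸ R := R.mkQ.comp (LinearMap.inr Λ P Q)
  have hcomm : ∀ m, iP (f m) = iQ (g m) := by
    intro m
    refine (Submodule.Quotient.eq R).2 ⟨m, ?_⟩
    simp
  have hiQ : Function.Injective iQ := by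
    rw [← LinearMap.ker_eq_bot, LinearMap.ker_eq_bot']
    intro y hy
    obtain ⟨m, hm⟩ := (Submodule.Quotient.mk_eq_zero R).1 hy
    simp only [LinearMap.prod_apply, Function.prod_apply, LinearMap.coe_inr, Prod.mk.injEq] at hm
    have hm0 : m = 0 := hf (by rw [hm.1, map_zero])
    rw [← hm.2, hm0, map_zero]
  have hsum : ∀ x : (P × Q) ⧸ R, ∃ a b, x = iP a + iQ b := by
    intro x
    obtain ⟨⟨a, b⟩, rfl⟩ := R.mkQ_surjective x
    refine ⟨a, b, ?_⟩
    simp only [iP, iQ, LinearMap.comp_apply, ← map_add]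
    simp
  obtain ⟨U, p, hUf, hUi, hp, hinj⟩ := exists_summand (uniserial hQi) _ inferInstance iQ hiQ
  have hUu := uniserial hUi
  have hsurj : Function.Surjective (p.comp iQ) := by
    rcases hUu (LinearMap.range (p.comp iP)) (LinearMap.range (p.comp iQ)) with h | h
    · intro u
      obtain ⟨x, rfl⟩ := hp u
      obtain ⟨a, b, rfl⟩ := hsum x
      obtain ⟨c, hc⟩ := h ⟨a, rfl⟩
      refine ⟨c + b, ?_⟩
      rw [map_add, hc, map_add]
      rfl
    · have hPs : Function.Surjective (p.comp iP) := by
        intro u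
        obtain ⟨x, rfl⟩ := hp u
        obtain ⟨a, b, rfl⟩ := hsum x
        obtain ⟨c, hc⟩ := h ⟨b, rfl⟩
        refine ⟨a + c, ?_⟩
        rw [map_add, hc, map_add]
        rfl
      obtain ⟨k1, k2, -⟩ := key (uniserial hP.2.1) (p.comp iP) hPs (p.comp iQ) hinj
      have htop := no_proj_sub hP _ k1 k2
      intro u
      obtain ⟨a, rfl⟩ := hPs u
      have : a ∈ (LinearMap.range (p.comp iQ)).comap (p.comp iP) := by
        rw [htop]; trivial
      exact this
  let e := LinearEquiv.ofBijective (p.comp iQ) ⟨hinj, hsurj⟩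
  refine ⟨e.symm.toLinearMap.comp (p.comp iP), ?_⟩
  ext m
  show e.symm (p (iP (f m))) = g m
  rw [hcomm, LinearEquiv.symm_apply_eq]
  rfl

theorem extend_finite [IsNakayama Λ] {M P : Type u} [AddCommGroup M] [Module Λ M]
    [AddCommGroup P] [Module Λ P]
    (f : M →ₗ[Λ] P) (hf : Function.Injective f) (hP : IsMinimalProjective Λ P) :
    ∀ (X : Type u) [AddCommGroup X] [Module Λ X], Module.Finite Λ X →
      Module.Projective Λ X → ∀ g : M →ₗ[Λ] X, ∃ h : P →ₗ[Λ] X, h.comp f = g := by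
  apply decomp_induction (Λ := Λ)
  · intro X _ _ hs _ g
    exact ⟨0, LinearMap.ext fun m => Subsingleton.elim _ _⟩
  · intro X _ _ hF hi hp g
    exact extend_indec f hf hP hF hi hp g
  · intro X _ _ A B hAB hA hB hp g
    obtain ⟨a, ha⟩ := hA (proj_compl hAB hp) ((A.projectionOnto B hAB).comp g)
    obtain ⟨b, hb⟩ := hB (proj_compl hAB.symm hp) ((B.projectionOnto A hAB.symm).comp g)
    refine ⟨A.subtype.comp a + B.subtype.comp b, ?_⟩
    ext m
    have e1 := LinearMap.congr_fun ha m
    have e2 := LinearMap.congr_fun hb m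
    simp only [LinearMap.comp_apply] at e1 e2
    simp only [LinearMap.comp_apply, LinearMap.add_apply, e1, e2]
    exact Submodule.projection_add_projection_eq_self hAB (g m)

theorem extend_all [IsNakayama Λ] {M P : Type u} [AddCommGroup M] [Module Λ M]
    [AddCommGroup P] [Module Λ P]
    (f : M →ₗ[Λ] P) (hf : Function.Injective f) (hP : IsMinimalProjective Λ P)
    (Q : Type u) [AddCommGroup Q] [Module Λ Q] (hQ : Module.Projective Λ Q)
    (g : M →ₗ[Λ] Q) : ∃ h : P →ₗ[Λ] Q, h.comp f = g := by
  classical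
  have : IsArtinianRing Λ := artin
  have : IsNoetherianRing Λ := inferInstance
  have := minimal_finite hP
  have : Module.Finite Λ M := Module.Finite.of_injective f hf
  obtain ⟨s, hs⟩ := Module.projective_def.1 hQ
  obtain ⟨G, hG⟩ := (Module.Finite.fg_top : (⊤ : Submodule Λ M).FG)
  let T : Finset Q := G.biUnion fun m => (s (g m)).support
  have hT : ∀ m, (s (g m)).support ⊆ T := by
    intro m
    have h1 : (⊤ : Submodule Λ M) ≤ (Finsupp.supported Λ Λ (T : Set Q)).comap (s.comp g) := by
      rw [← hG, Submodule.span_le]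
      intro x hx
      rw [SetLike.mem_coe, Submodule.mem_comap, Finsupp.mem_supported]
      exact Finset.coe_subset.2 (Finset.subset_biUnion_of_mem (fun m => (s (g m)).support) hx)
    have h2 := h1 (Submodule.mem_top (x := m))
    rw [Submodule.mem_comap, Finsupp.mem_supported] at h2
    exact Finset.coe_subset.1 h2
  choose c hc using fun q : Q => extend_finite f hf hP Λ inferInstance inferInstance
    ((Finsupp.lapply q).comp (s.comp g))
  let h : P →ₗ[Λ] (Q →₀ Λ) := ∑ q ∈ T, (Finsupp.lsingle q).comp (c q)
  refine ⟨(Finsupp.linearCombination Λ id).comp h, ?_⟩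
  ext m
  have hh : h (f m) = s (g m) := by
    have e : ∀ q, c q (f m) = s (g m) q := fun q => LinearMap.congr_fun (hc q) m
    simp only [h, LinearMap.sum_apply, LinearMap.comp_apply, e, Finsupp.lsingle_apply]
    conv_rhs => rw [← Finsupp.sum_single (s (g m))]
    rw [Finsupp.sum_of_support_subset _ (hT m)]
    simp
  show Finsupp.linearCombination Λ id (h (f m)) = g m
  rw [hh]
  exact hs (g m)

end

end NakHelp

/-- For a Nakayama algebra without simple projectives, an embedding `f : M → P` of an
indecomposable non-projective torsionless module `M` into a minimal projective module `P`
is a minimal left `Λ`-approximation by projective modules: every map from `M` to a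
projective module factors through `f`, and every endomorphism `e` of `P` with `e ∘ f = f`
is an automorphism. -/
theorem embedding_into_minimal_projective_is_minimal_left_approximation
    [IsNakayama Λ] (h0 : NoSimpleProjectives Λ)
    (M P : Type u) [AddCommGroup M] [Module Λ M] [AddCommGroup P] [Module Λ P]
    (hfl : ∃ n, HasLength Λ M n) (hind : IsIndecomposableMod Λ M)
    (hnp : ¬ Module.Projective Λ M)
    (f : M →ₗ[Λ] P) (hf : Function.Injective f) (hP : IsMinimalProjective Λ P) :
    (∀ (Q : Type u) [AddCommGroup Q] [Module Λ Q], Module.Projective Λ Q →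
      ∀ g : M →ₗ[Λ] Q, ∃ h : P →ₗ[Λ] Q, h.comp f = g) ∧
    ∀ e : P →ₗ[Λ] P, e.comp f = f → Function.Bijective e := by
  refine ⟨fun Q _ _ hQ g => NakHelp.extend_all f hf hP Q hQ g, fun e he => ?_⟩
  have : IsArtinianRing Λ := NakHelp.artin
  have := NakHelp.minimal_finite hP
  have := hind.1
  have hinj : Function.Injective e := by
    have hd : LinearMap.ker e ⊓ LinearMap.range f = ⊥ := by
      rw [eq_bot_iff]
      rintro _ ⟨h, m, rfl⟩
      have h1 : e (f m) = f m := LinearMap.congr_fun he m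
      have h2 : e (f m) = 0 := h
      rw [h1] at h2
      exact h2
    rw [← LinearMap.ker_eq_bot]
    rcases NakHelp.uniserial hP.2.1 (LinearMap.ker e) (LinearMap.range f) with h | h
    · rwa [inf_eq_left.2 h] at hd
    · rw [inf_eq_right.2 h, LinearMap.range_eq_bot] at hd
      exfalso
      obtain ⟨m, hm⟩ := exists_ne (0 : M)
      exact hm (hf (by rw [hd]; rfl))
  exact IsArtinian.bijective_of_injective_endomorphism e hinj
end

section
/- Let Λ be a Nakayama algebra and M indecomposable non-projective. Then M is Gorenstein projective if and only if both top M and top Ω(M) are cyclically black in the resolution quiver, if and only if both top M and τ soc M are cyclically black. -/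
universe u

variable (Λ : Type u) [Ring Λ]

section Helpers

variable {Λ}

instance nakayamaArtinian [IsNakayama Λ] : IsArtinianRing Λ := IsNakayama.artinian

theorem exists_hasLength (M : Type u) [AddCommGroup M] [Module Λ M]
    (h : IsFiniteLength Λ M) : ∃ n, HasLength Λ M n := by
  obtain ⟨s, h1, h2⟩ := isFiniteLength_iff_exists_compositionSeries.1 h
  exact ⟨s.length, s.toFun, h1, h2, fun i => s.step i⟩

theorem isFiniteLength_of_hasLength {M : Type u} [AddCommGroup M] [Module Λ M] {n : ℕ}
    (h : HasLength Λ M n) : IsFiniteLength Λ M := by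
  obtain ⟨c, h1, h2, h3⟩ := h
  exact isFiniteLength_iff_exists_compositionSeries.2 ⟨⟨n, c, h3⟩, h1, h2⟩

theorem finite_of_hasLength {M : Type u} [AddCommGroup M] [Module Λ M] {n : ℕ}
    (h : HasLength Λ M n) : Module.Finite Λ M := by
  have := (isFiniteLength_iff_isNoetherian_isArtinian.1 (isFiniteLength_of_hasLength h)).1
  infer_instance

theorem exists_hasLength_of_finite [IsNakayama Λ] (M : Type u) [AddCommGroup M] [Module Λ M]
    [Module.Finite Λ M] : ∃ n, HasLength Λ M n :=
  exists_hasLength M (isFiniteLength_iff_isNoetherian_isArtinian.2 ⟨inferInstance, inferInstance⟩)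

/-- Induction over decompositions. -/
theorem decomp_ind [IsNakayama Λ]
    (motive : ∀ (X : Type u) [AddCommGroup X] [Module Λ X], Prop)
    (huni : ∀ (X : Type u) [AddCommGroup X] [Module Λ X] [Module.Finite Λ X],
      IsUniserialMod Λ X → motive X)
    (hsum : ∀ (X : Type u) [AddCommGroup X] [Module Λ X] [Module.Finite Λ X]
      (N N' : Submodule Λ X), IsCompl N N' → motive N → motive N' → motive X)
    (X : Type u) [AddCommGroup X] [Module Λ X] [Module.Finite Λ X] : motive X := by
  suffices H : ∀ n : ℕ, ∀ (X : Type u) [AddCommGroup X] [Module Λ X] [Module.Finite Λ X],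
      Module.length Λ X = n → motive X by
    obtain ⟨n, hn⟩ := ENat.ne_top_iff_exists.1 (Module.length_ne_top (R := Λ) (M := X))
    exact H n X hn.symm
  intro n
  induction n using Nat.strong_induction_on with
  | _ n ih =>
    intro X _ _ _ hX
    have key : ∀ N : Submodule Λ X, N ≠ ⊤ → motive N := by
      intro N hN
      have h1 := Submodule.length_lt hN
      obtain ⟨m, hm⟩ := ENat.ne_top_iff_exists.1 (Module.length_ne_top (R := Λ) (M := N))
      rw [hX, ← hm] at h1
      exact ih m (by exact_mod_cast h1) N hm.symm
    by_cases hs : Subsingleton X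
    · exact huni X (fun N N' => Or.inl (by rw [Subsingleton.elim N N']))
    rw [not_subsingleton_iff_nontrivial] at hs
    by_cases hi : IsIndecomposableMod Λ X
    · exact huni X (IsNakayama.serial X (exists_hasLength_of_finite X) hi)
    · simp only [IsIndecomposableMod, hs, true_and, not_forall, not_or] at hi
      obtain ⟨N, N', hc, h1, h2⟩ := hi
      refine hsum X N N' hc (key N ?_) (key N' ?_)
      · rintro rfl
        exact h2 (by simpa using hc.inf_eq_bot)
      · rintro rfl
        exact h1 (by simpa using hc.inf_eq_bot)

section Uni

variable {M N : Type u} [AddCommGroup M] [Module Λ M] [AddCommGroup N] [Module Λ N]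

theorem uni_of_surj (f : M →ₗ[Λ] N) (hf : Function.Surjective f) (h : IsUniserialMod Λ M) :
    IsUniserialMod Λ N := by
  intro A B
  rcases h (A.comap f) (B.comap f) with h | h
  · left
    exact (Submodule.comap_le_comap_iff_of_surjective hf).1 h
  · right
    exact (Submodule.comap_le_comap_iff_of_surjective hf).1 h

theorem uni_of_inj (f : M →ₗ[Λ] N) (hf : Function.Injective f) (h : IsUniserialMod Λ N) :
    IsUniserialMod Λ M := by
  intro A B
  rcases h (A.map f) (B.map f) with h | h
  · left
    exact (Submodule.map_le_map_iff_of_injective hf _ _).1 h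
  · right
    exact (Submodule.map_le_map_iff_of_injective hf _ _).1 h

theorem uni_sub (h : IsUniserialMod Λ M) (A : Submodule Λ M) : IsUniserialMod Λ A :=
  uni_of_inj A.subtype A.injective_subtype h

theorem uni_sup_top (h : IsUniserialMod Λ M) {A B : Submodule Λ M} (hAB : A ⊔ B = ⊤) :
    A = ⊤ ∨ B = ⊤ := by
  rcases h A B with h | h
  · right; rwa [sup_eq_right.2 h] at hAB
  · left; rwa [sup_eq_left.2 h] at hAB

theorem uni_inf_bot (h : IsUniserialMod Λ M) {A B : Submodule Λ M} (hAB : A ⊓ B = ⊥) :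
    A = ⊥ ∨ B = ⊥ := by
  rcases h A B with h | h
  · left; rwa [inf_eq_left.2 h] at hAB
  · right; rwa [inf_eq_right.2 h] at hAB

/-- In a uniserial module, an endomorphism-like map which becomes surjective modulo a proper
submodule is surjective. -/
theorem uni_surj_of_comp {K : Type u} [AddCommGroup K] [Module Λ K] [Nontrivial N]
    (h : IsUniserialMod Λ M) (g : M →ₗ[Λ] N) (f : K →ₗ[Λ] M)
    (hgf : Function.Surjective (g.comp f)) : Function.Surjective f := by
  have h1 : LinearMap.range f ⊔ LinearMap.ker g = ⊤ := by
    rw [eq_top_iff]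
    intro x _
    obtain ⟨k, hk⟩ := hgf (g x)
    have : x = f k + (x - f k) := by abel
    rw [this]
    refine Submodule.add_mem_sup ⟨k, rfl⟩ ?_
    rw [LinearMap.mem_ker, map_sub, ← hk]
    simp
  rcases uni_sup_top h h1 with h2 | h2
  · exact LinearMap.range_eq_top.1 h2
  · exfalso
    obtain ⟨y, hy⟩ := exists_ne (0 : N)
    obtain ⟨k, hk⟩ := hgf y
    apply hy
    rw [← hk]
    have : f k ∈ LinearMap.ker g := by rw [h2]; trivial
    exact this

/-- A map from a uniserial module injective on a nonzero submodule is injective. -/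
theorem uni_inj_of_comp {K : Type u} [AddCommGroup K] [Module Λ K] [Nontrivial K]
    (h : IsUniserialMod Λ M) (g : M →ₗ[Λ] N) (f : K →ₗ[Λ] M)
    (hgf : Function.Injective (g.comp f)) : Function.Injective g := by
  have h1 : LinearMap.range f ⊓ LinearMap.ker g = ⊥ := by
    rw [eq_bot_iff]
    rintro _ ⟨⟨k, rfl⟩, hk⟩
    have : (g.comp f) k = (g.comp f) 0 := by simpa using hk
    rw [hgf this]
    simp
  rcases uni_inf_bot h h1 with h2 | h2
  · exfalso
    obtain ⟨y, hy⟩ := exists_ne (0 : K)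
    apply hy
    apply hgf
    have : f y ∈ LinearMap.range f := ⟨y, rfl⟩
    rw [h2] at this
    have h3 : f y = 0 := by simpa using this
    simp [h3]
  · exact LinearMap.ker_eq_bot.1 h2

theorem rad_isCoatom [IsNakayama Λ] [Module.Finite Λ M] [Nontrivial M]
    (h : IsUniserialMod Λ M) : IsCoatom (modRadical Λ M) := by
  obtain ⟨A, hA, -⟩ := (IsCoatomic.eq_top_or_exists_le_coatom (⊥ : Submodule Λ M)).resolve_left
    bot_ne_top
  have : modRadical Λ M = A := by
    apply le_antisymm
    · exact sInf_le hA
    · refine le_sInf ?_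
      intro B hB
      rcases h A B with h | h
      · exact h
      · rcases eq_or_lt_of_le h with h | h
        · exact h.ge
        · exact absurd (hB.2 _ h) hA.1
  rwa [this]

theorem eq_rad_of_isCoatom (h : IsUniserialMod Λ M) {A : Submodule Λ M} (hA : IsCoatom A) :
    A = modRadical Λ M := by
  apply le_antisymm
  · refine le_sInf ?_
    intro B hB
    rcases h A B with h | h
    · exact h
    · rcases eq_or_lt_of_le h with h | h
      · exact h.ge
      · exact absurd (hB.2 _ h) hA.1
  · exact sInf_le hA

theorem le_rad [IsNakayama Λ] [Module.Finite Λ M] 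
    (h : IsUniserialMod Λ M) {A : Submodule Λ M} (hA : A ≠ ⊤) : A ≤ modRadical Λ M := by
  obtain ⟨B, hB, hAB⟩ := (IsCoatomic.eq_top_or_exists_le_coatom A).resolve_left hA
  rwa [← eq_rad_of_isCoatom h hB]

theorem isCoatom_ker {S : Type u} [AddCommGroup S] [Module Λ S] [hS : IsSimpleModule Λ S]
    (f : M →ₗ[Λ] S) (hf : Function.Surjective f) : IsCoatom (LinearMap.ker f) := by
  rw [← isSimpleModule_iff_isCoatom]
  exact IsSimpleModule.congr (f.quotKerEquivOfSurjective hf)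

theorem isTopOf_of_surj {S : Type u} [AddCommGroup S] [Module Λ S] (hS : IsSimpleModule Λ S)
    (h : IsUniserialMod Λ M)
    (f : M →ₗ[Λ] S) (hf : Function.Surjective f) : IsTopOf Λ S M :=
  ⟨hS, f, hf, eq_rad_of_isCoatom h (isCoatom_ker f hf)⟩

theorem isTop_unique {S T : Type u} [AddCommGroup S] [Module Λ S] [AddCommGroup T] [Module Λ T]
    (h : IsTopOf Λ S M) (h' : IsTopOf Λ T M) : Nonempty (S ≃ₗ[Λ] T) := by
  obtain ⟨-, p, hp, hk⟩ := h
  obtain ⟨-, q, hq, hk'⟩ := h'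
  exact ⟨(p.quotKerEquivOfSurjective hp).symm.trans
    ((Submodule.quotEquivOfEq _ _ (hk.trans hk'.symm)).trans (q.quotKerEquivOfSurjective hq))⟩

theorem exists_top [IsNakayama Λ] [Module.Finite Λ M] [Nontrivial M]
    (h : IsUniserialMod Λ M) : IsTopOf Λ (M ⧸ modRadical Λ M) M :=
  ⟨isSimpleModule_iff_isCoatom.2 (rad_isCoatom h), Submodule.mkQ _, Submodule.mkQ_surjective _,
    Submodule.ker_mkQ _⟩

/-- dual of nonzero: a finite module maps to a uniserial one without killing a given element -/
theorem exists_uni_quot [IsNakayama Λ] (X : Type u) [AddCommGroup X] [Module Λ X]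
    [Module.Finite Λ X] : ∀ x : X, x ≠ 0 → ∃ (Y : ModuleCat.{u} Λ) (f : X →ₗ[Λ] Y),
      IsUniserialMod Λ Y ∧ f x ≠ 0 := by
  refine decomp_ind (Λ := Λ) (fun X _ _ => ∀ x : X, x ≠ 0 → ∃ (Y : ModuleCat.{u} Λ)
    (f : X →ₗ[Λ] Y), IsUniserialMod Λ Y ∧ f x ≠ 0) ?_ ?_ X
  · intro X _ _ _ hX x hx
    exact ⟨ModuleCat.of Λ X, LinearMap.id, hX, hx⟩
  · intro X _ _ _ A B hc hA hB x hx
    by_cases h : A.projectionOnto B hc x = 0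
    · have hxB : x ∈ B := by simpa using h
      by_cases h' : B.projectionOnto A hc.symm x = 0
      · have hxA : x ∈ A := by simpa using h'
        have : x ∈ A ⊓ B := ⟨hxA, hxB⟩
        rw [hc.inf_eq_bot] at this
        exact absurd (by simpa using this) hx
      · obtain ⟨Y, f, hY, hf⟩ := hB _ h'
        exact ⟨Y, f.comp (B.projectionOnto A hc.symm), hY, hf⟩
    · obtain ⟨Y, f, hY, hf⟩ := hA _ h
      exact ⟨Y, f.comp (A.projectionOnto B hc), hY, hf⟩

/-- existence of uniserial projective covers -/
theorem exists_cover [IsNakayama Λ] [Module.Finite Λ M] (h : IsUniserialMod Λ M) :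
    ∃ (P : ModuleCat.{u} Λ) (p : P →ₗ[Λ] M), Module.Projective Λ P ∧ Module.Finite Λ P ∧
      IsUniserialMod Λ P ∧ Function.Surjective p := by
  obtain ⟨n, f, hf⟩ := Module.Finite.exists_fin' Λ M
  have : ∀ (A : Type u) [AddCommGroup A] [Module Λ A] [Module.Finite Λ A],
      Module.Projective Λ A → ∀ f : A →ₗ[Λ] M, Function.Surjective f → 
        ∃ (P : ModuleCat.{u} Λ) (p : P →ₗ[Λ] M), Module.Projective Λ P ∧ Module.Finite Λ P ∧
      IsUniserialMod Λ P ∧ Function.Surjective p := by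
    intro A _ _ _
    refine decomp_ind (Λ := Λ) (fun A _ _ => 
      Module.Projective Λ A → ∀ f : A →ₗ[Λ] M, Function.Surjective f → 
        ∃ (P : ModuleCat.{u} Λ) (p : P →ₗ[Λ] M), Module.Projective Λ P ∧ Module.Finite Λ P ∧
      IsUniserialMod Λ P ∧ Function.Surjective p) ?_ ?_ A
    · intro X _ _ _ hX hP f hf
      exact ⟨ModuleCat.of Λ X, f, hP, ‹_›, hX, hf⟩
    · intro X _ _ _ A B hc hA hB hP f hf
      have hPA : Module.Projective Λ A :=
        Module.Projective.of_split A.subtype (A.projectionOnto B hc) (by ext; simp)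
      have hPB : Module.Projective Λ B :=
        Module.Projective.of_split B.subtype (B.projectionOnto A hc.symm) (by ext; simp)
      have h1 : A.map f ⊔ B.map f = ⊤ := by
        rw [← Submodule.map_sup, hc.sup_eq_top, Submodule.map_top, LinearMap.range_eq_top.2 hf]
      rcases uni_sup_top h h1 with h2 | h2
      · refine hA hPA (f.comp A.subtype) ?_
        rw [← LinearMap.range_eq_top, LinearMap.range_comp, Submodule.range_subtype, h2]
      · refine hB hPB (f.comp B.subtype) ?_
        rw [← LinearMap.range_eq_top, LinearMap.range_comp, Submodule.range_subtype, h2]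
  exact this (Fin n → Λ) inferInstance f hf

end Uni

section Covers2

variable {M P : Type u} [AddCommGroup M] [Module Λ M] [AddCommGroup P] [Module Λ P]

theorem isProjCover_of_uni [IsNakayama Λ] [Nontrivial M] [Module.Finite Λ P]
    (hP : Module.Projective Λ P) (hu : IsUniserialMod Λ P) (p : P →ₗ[Λ] M)
    (hp : Function.Surjective p) : IsProjCover p := by
  refine ⟨hP, hp, le_rad hu ?_⟩
  intro h
  rw [LinearMap.ker_eq_top] at h
  obtain ⟨y, hy⟩ := exists_ne (0 : M)
  obtain ⟨x, hx⟩ := hp y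
  apply hy
  rw [← hx, h]
  rfl

theorem exists_coatom_of_proj [IsNakayama Λ] {P : Type u} [AddCommGroup P] [Module Λ P]
    (hP : Module.Projective Λ P) (x : P) (hx : x ≠ 0) : ∃ φ : P →ₗ[Λ] Λ, φ x ≠ 0 := by
  obtain ⟨s, hs⟩ := hP.out
  by_contra! hcon
  apply hx
  rw [← hs x]
  have : s x = 0 := by
    ext y
    exact hcon ((Finsupp.lapply y).comp s)
  rw [this]
  simp

theorem cover_equiv [IsNakayama Λ] [Nontrivial M] [Module.Finite Λ P]
    (hP : Module.Projective Λ P) (hu : IsUniserialMod Λ P) (q : P →ₗ[Λ] M)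
    (hq : Function.Surjective q) {P' : Type u} [AddCommGroup P'] [Module Λ P'] (p : P' →ₗ[Λ] M)
    (hp : IsProjCover p) : ∃ e : P' ≃ₗ[Λ] P, q.comp (e : P' →ₗ[Λ] P) = p := by
  obtain ⟨hP', hps, hsup⟩ := hp
  obtain ⟨f, hf⟩ := Module.projective_lifting_property q p hq
  have hfs : Function.Surjective f := uni_surj_of_comp hu q f (by rw [hf]; exact hps)
  obtain ⟨s, hs⟩ := Module.projective_lifting_property f LinearMap.id hfs
  have hs' : ∀ y, f (s y) = y := fun y => by
    have := LinearMap.congr_fun hs y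
    simpa using this
  have hinj : Function.Injective f := by
    rw [← LinearMap.ker_eq_bot, eq_bot_iff]
    intro x hx
    by_contra hx0
    obtain ⟨φ, hφ⟩ := exists_coatom_of_proj hP' x (by simpa using hx0)
    let g : P' →ₗ[Λ] Λ := φ.comp (LinearMap.id - s.comp f)
    have hgx : g x = φ x := by
      have : f x = 0 := hx
      simp [g, this]
    have hnt : (⊥ : Submodule Λ (LinearMap.range g)) ≠ ⊤ := by
      intro h
      have h1 : (⟨g x, x, rfl⟩ : LinearMap.range g) ∈ (⊥ : Submodule Λ (LinearMap.range g)) := by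
        rw [h]; trivial
      have h2 : g x = 0 := congrArg Subtype.val ((Submodule.mem_bot Λ).1 h1)
      exact hφ (hgx ▸ h2)
    obtain ⟨J, hJ, -⟩ := (IsCoatomic.eq_top_or_exists_le_coatom
      (⊥ : Submodule Λ (LinearMap.range g))).resolve_left hnt
    have hJ' : IsCoatom (J.comap g.rangeRestrict) := by
      rw [← isSimpleModule_iff_isCoatom] at hJ ⊢
      have h3 : LinearMap.ker (J.mkQ.comp g.rangeRestrict) = J.comap g.rangeRestrict := by
        rw [LinearMap.ker_comp, Submodule.ker_mkQ]
      rw [← h3]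
      exact IsSimpleModule.congr (LinearMap.quotKerEquivOfSurjective _
        (J.mkQ_surjective.comp g.surjective_rangeRestrict))
    have hle : modRadical Λ P' ≤ J.comap g.rangeRestrict := sInf_le hJ'
    apply hJ.1
    rw [eq_top_iff]
    rintro ⟨_, y, rfl⟩ -
    have h4 : y - s (f y) ∈ LinearMap.ker p := by
      rw [← hf]
      simp [hs']
    have h5 := hle (hsup h4)
    have h6 : g.rangeRestrict (y - s (f y)) = ⟨g y, y, rfl⟩ := by
      ext
      simp [g, hs']
    rw [Submodule.mem_comap, h6] at h5
    exact h5
  exact ⟨LinearEquiv.ofBijective f ⟨hinj, hfs⟩, hf⟩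

theorem inj_of_surj_proj {A B : Type u} [AddCommGroup A] [Module Λ A] [AddCommGroup B]
    [Module Λ B] (hA : IsUniserialMod Λ A) [Nontrivial B] (hB : Module.Projective Λ B)
    (r : A →ₗ[Λ] B) (hr : Function.Surjective r) : Function.Injective r := by
  obtain ⟨s, hs⟩ := Module.projective_lifting_property r LinearMap.id hr
  refine uni_inj_of_comp hA r s ?_
  rw [hs]
  exact Function.injective_id

/-- A uniserial module with a nonzero projective submodule is projective. -/
theorem proj_of_sub [IsNakayama Λ] [Module.Finite Λ M] (hM : IsUniserialMod Λ M)
    (R : Submodule Λ M) (hR : R ≠ ⊥) (hRp : Module.Projective Λ R) : Module.Projective Λ M := by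
  obtain ⟨P, p, hP, hPf, hPu, hp⟩ := exists_cover hM
  have : Nontrivial R := (Submodule.nontrivial_iff_ne_bot).2 hR
  let r : R.comap p →ₗ[Λ] R := p.restrict (fun x hx => hx)
  have hr : Function.Surjective r := by
    rintro ⟨y, hy⟩
    obtain ⟨x, rfl⟩ := hp y
    exact ⟨⟨x, hy⟩, rfl⟩
  have hri := inj_of_surj_proj (uni_sub hPu _) hRp r hr
  have hpi : Function.Injective p := by
    rw [← LinearMap.ker_eq_bot, eq_bot_iff]
    intro x hx
    have hx0 : p x = 0 := hx
    have h1 : r ⟨x, by simp [hx0]⟩ = r 0 := by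
      ext
      simp [r, hx0]
    have := hri h1
    simpa using congrArg Subtype.val this
  exact Module.Projective.of_equiv (LinearEquiv.ofBijective p ⟨hpi, hp⟩)

theorem proj_rad_of_sub [IsNakayama Λ] [Module.Finite Λ M] (hM : IsUniserialMod Λ M)
    (R : Submodule Λ M) (hR : R ≠ ⊥) (hR' : R ≠ ⊤) (hRp : Module.Projective Λ R) :
    Module.Projective Λ (modRadical Λ M) := by
  have hle := le_rad hM hR'
  let e := Submodule.submoduleOfEquivOfLe hle
  refine proj_of_sub (uni_sub hM _) (R.submoduleOf (modRadical Λ M)) ?_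
    (Module.Projective.of_equiv e.symm)
  intro h
  apply hR
  rw [eq_bot_iff]
  intro x hx
  have : (⟨x, hle hx⟩ : modRadical Λ M) ∈ R.submoduleOf (modRadical Λ M) := hx
  rw [h] at this
  simpa using this

theorem ext_dichotomy [IsNakayama Λ] {U V W : Type u} [AddCommGroup U] [Module Λ U]
    [AddCommGroup V] [Module Λ V] [AddCommGroup W] [Module Λ W] [Module.Finite Λ U]
    [Module.Finite Λ V] [Module.Finite Λ W] [Nontrivial U] (hU : IsUniserialMod Λ U)
    (hV : IsUniserialMod Λ V) (hW : IsUniserialMod Λ W) (i : U →ₗ[Λ] V)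
    (hi : Function.Injective i) (g : U →ₗ[Λ] W) (hg : Function.Injective g) :
    (∃ h : V →ₗ[Λ] W, h.comp i = g) ∨ (∃ h : W →ₗ[Λ] V, h.comp g = i) := by
  let D : Submodule Λ (V × W) := LinearMap.range (i.prod (-g))
  let a : V →ₗ[Λ] (V × W) ⧸ D := D.mkQ.comp (LinearMap.inl Λ V W)
  let b : W →ₗ[Λ] (V × W) ⧸ D := D.mkQ.comp (LinearMap.inr Λ V W)
  have hab : a.comp i = b.comp g := by
    ext u
    simp only [a, b, LinearMap.comp_apply]
    rw [← sub_eq_zero, ← map_sub, ← LinearMap.mem_ker, Submodule.ker_mkQ]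
    exact ⟨u, by simp⟩
  have hai : Function.Injective (a.comp i) := by
    rw [← LinearMap.ker_eq_bot, eq_bot_iff]
    intro u hu
    have h1 : (i u, (0 : W)) ∈ LinearMap.ker D.mkQ := hu
    rw [Submodule.ker_mkQ] at h1
    obtain ⟨u', hu'⟩ := h1
    have h2 : i u' = i u := congrArg Prod.fst hu'
    have h3 : -g u' = 0 := congrArg Prod.snd hu'
    have h4 : u' = 0 := hg (by simpa using h3)
    have h5 : u' = u := hi h2
    rw [← h5, h4]
    simp
  obtain ⟨A, hA, -⟩ := (IsAtomic.eq_bot_or_exists_atom_le (⊤ : Submodule Λ U)).resolve_left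
    top_ne_bot
  obtain ⟨u, huA, hu0⟩ := A.exists_mem_ne_zero_of_ne_bot hA.1
  obtain ⟨Y, f, hY, hf⟩ := exists_uni_quot (Λ := Λ) ((V × W) ⧸ D) (a.comp i u)
    (fun h => hu0 (hai (by simpa using h)))
  have hfi : Function.Injective ((f.comp a).comp i) := by
    rw [← LinearMap.ker_eq_bot]
    rcases hU (LinearMap.ker ((f.comp a).comp i)) A with h | h
    · rcases eq_or_lt_of_le h with h | h
      · exfalso
        rw [← h] at huA
        exact hf huA
      · exact hA.2 _ h
    · exact absurd (h huA) hf
  have hfi' : Function.Injective ((f.comp b).comp g) := by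
    rw [LinearMap.comp_assoc, ← hab]
    exact hfi
  have ha := uni_inj_of_comp hV (f.comp a) i hfi
  have hb := uni_inj_of_comp hW (f.comp b) g hfi'
  have key : ∀ u, f (a (i u)) = f (b (g u)) := fun u =>
    congrArg f (LinearMap.congr_fun hab u)
  rcases hY (LinearMap.range (f.comp a)) (LinearMap.range (f.comp b)) with h | h
  · left
    refine ⟨((LinearEquiv.ofInjective _ hb).symm : _ →ₗ[Λ] W).comp
      ((Submodule.inclusion h).comp (f.comp a).rangeRestrict), ?_⟩
    ext u
    apply (LinearEquiv.ofInjective _ hb).injective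
    ext
    simp [key]
  · right
    refine ⟨((LinearEquiv.ofInjective _ ha).symm : _ →ₗ[Λ] V).comp
      ((Submodule.inclusion h).comp (f.comp b).rangeRestrict), ?_⟩
    ext u
    apply (LinearEquiv.ofInjective _ ha).injective
    ext
    simp [key]

/-- Vanishing of `Ext¹` for black tops. -/
theorem extend_of_black [IsNakayama Λ] [Module.Finite Λ P]
    (hP : Module.Projective Λ P) (hu : IsUniserialMod Λ P)
    (hb : ¬ Module.Projective Λ (modRadical Λ P)) (N : Submodule Λ P) (hN : N ≠ ⊥)
    (W : Type u) [AddCommGroup W] [Module Λ W] [Module.Finite Λ W] :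
    Module.Projective Λ W → ∀ g : N →ₗ[Λ] W, ∃ h : P →ₗ[Λ] W, h.comp N.subtype = g := by
  refine decomp_ind (Λ := Λ) (fun W _ _ => Module.Projective Λ W → ∀ g : N →ₗ[Λ] W,
    ∃ h : P →ₗ[Λ] W, h.comp N.subtype = g) ?_ ?_ W
  · intro W _ _ _ hW hWp g
    by_cases hg0 : g = 0
    · exact ⟨0, by simp [hg0]⟩
    let K : Submodule Λ P := (LinearMap.ker g).map N.subtype
    have hK : LinearMap.ker g ≤ K.comap N.subtype := Submodule.le_comap_map _ _
    let g' : (N ⧸ LinearMap.ker g) →ₗ[Λ] W := (LinearMap.ker g).liftQ g le_rfl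
    have hg' : Function.Injective g' := by
      rw [← LinearMap.ker_eq_bot, Submodule.ker_liftQ_eq_bot]
      exact le_rfl
    let i : (N ⧸ LinearMap.ker g) →ₗ[Λ] P ⧸ K := (LinearMap.ker g).mapQ K N.subtype hK
    have hi : Function.Injective i := by
      rw [← LinearMap.ker_eq_bot]
      simp only [i, Submodule.mapQ]
      rw [Submodule.ker_liftQ_eq_bot]
      rw [LinearMap.ker_comp, Submodule.ker_mkQ]
      simp only [K]
      rw [Submodule.comap_map_eq_of_injective N.injective_subtype]
    have : Nontrivial (N ⧸ LinearMap.ker g) := by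
      rw [Submodule.Quotient.nontrivial_iff]
      intro h
      exact hg0 (LinearMap.ker_eq_top.1 h)
    have hV : IsUniserialMod Λ (P ⧸ K) := uni_of_surj K.mkQ K.mkQ_surjective hu
    have hU : IsUniserialMod Λ (N ⧸ LinearMap.ker g) :=
      uni_of_surj (Submodule.mkQ _) (Submodule.mkQ_surjective _) (uni_sub hu N)
    rcases ext_dichotomy hU hV hW i hi g' hg' with ⟨h, hh⟩ | ⟨h, hh⟩
    · refine ⟨h.comp K.mkQ, ?_⟩
      ext n
      have := LinearMap.congr_fun hh (Submodule.Quotient.mk n)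
      simpa [i, g'] using this
    · have hinj : Function.Injective h := uni_inj_of_comp hW h g' (by rw [hh]; exact hi)
      have hn : ∀ n : N, h (g n) = K.mkQ n := by
        intro n
        have := LinearMap.congr_fun hh (Submodule.Quotient.mk n)
        simpa [i, g'] using this
      by_cases hs : LinearMap.range h = ⊤
      · let e := LinearEquiv.ofBijective h ⟨hinj, LinearMap.range_eq_top.1 hs⟩
        refine ⟨(e.symm : _ →ₗ[Λ] W).comp K.mkQ, ?_⟩
        ext n
        apply e.injective
        have h2 : e (g n) = K.mkQ n := hn n
        rw [h2]
        simp
      · exfalso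
        let R := (LinearMap.range h).comap K.mkQ
        have hNR : N ≤ R := by
          intro n hnN
          exact ⟨g ⟨n, hnN⟩, hn ⟨n, hnN⟩⟩
        have hWn : Nontrivial W := by
          by_contra hcon
          rw [not_nontrivial_iff_subsingleton] at hcon
          exact hg0 (Subsingleton.elim _ _)
        let r : R →ₗ[Λ] W := ((LinearEquiv.ofInjective h hinj).symm : _ →ₗ[Λ] W).comp
          (K.mkQ.restrict (p := R) (q := LinearMap.range h) (fun x hx => hx))
        have hr : Function.Surjective r := by
          intro w
          obtain ⟨x, hx⟩ := K.mkQ_surjective (h w)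
          refine ⟨⟨x, w, hx.symm⟩, ?_⟩
          apply (LinearEquiv.ofInjective h hinj).injective
          ext
          simpa [r] using hx
        have hri := inj_of_surj_proj (uni_sub hu R) hWp r hr
        have hRp : Module.Projective Λ R :=
          Module.Projective.of_equiv (LinearEquiv.ofBijective r ⟨hri, hr⟩).symm
        refine hb (proj_rad_of_sub hu R ?_ ?_ hRp)
        · rintro h0
          rw [h0] at hNR
          exact hN (by simpa using hNR)
        · intro h1
          apply hs
          rw [eq_top_iff]
          rintro y -
          obtain ⟨x, rfl⟩ := K.mkQ_surjective y
          have : x ∈ R := by rw [h1]; trivial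
          exact this
  · intro X _ _ _ A B hc hA hB hX g
    have hPA : Module.Projective Λ A :=
      Module.Projective.of_split A.subtype (A.projectionOnto B hc) (by ext; simp)
    have hPB : Module.Projective Λ B :=
      Module.Projective.of_split B.subtype (B.projectionOnto A hc.symm) (by ext; simp)
    obtain ⟨h1, hh1⟩ := hA hPA ((A.projectionOnto B hc).comp g)
    obtain ⟨h2, hh2⟩ := hB hPB ((B.projectionOnto A hc.symm).comp g)
    refine ⟨A.subtype.comp h1 + B.subtype.comp h2, ?_⟩
    ext n
    have e1 := LinearMap.congr_fun hh1 n
    have e2 := LinearMap.congr_fun hh2 n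
    simp only [LinearMap.comp_apply, Submodule.subtype_apply] at e1 e2
    simp only [LinearMap.comp_apply, LinearMap.add_apply, Submodule.subtype_apply, e1, e2]
    exact Submodule.projection_add_projection_eq_self hc (g n)

theorem black_of_extend [IsNakayama Λ] [Module.Finite Λ P]
    (hu : IsUniserialMod Λ P)
    (N : Submodule Λ P) (hN : N ≠ ⊥) (hN' : N ≠ ⊤)
    (hext : ∀ φ : N →ₗ[Λ] Λ, ∃ ψ : P →ₗ[Λ] Λ, ψ.comp N.subtype = φ) :
    ¬ Module.Projective Λ (modRadical Λ P) := by
  intro hR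
  have hle := le_rad hu hN'
  obtain ⟨n, f, hf⟩ := Module.Finite.exists_fin' Λ (modRadical Λ P)
  obtain ⟨s, hs⟩ := Module.projective_lifting_property f LinearMap.id hf
  let ι : N →ₗ[Λ] (Fin n → Λ) := s.comp (Submodule.inclusion hle)
  choose ψ hψ using fun j : Fin n => hext ((LinearMap.proj j).comp ι)
  let g : P →ₗ[Λ] P := (modRadical Λ P).subtype.comp (f.comp (LinearMap.pi ψ))
  have hg : ∀ x : N, g x = x := by
    intro x
    have h1 : LinearMap.pi ψ (x : P) = ι x := by
      ext j
      exact LinearMap.congr_fun (hψ j) x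
    have h2 : f (s (Submodule.inclusion hle x)) = Submodule.inclusion hle x :=
      LinearMap.congr_fun hs _
    simp [g, h1, ι, h2]
  have : Nontrivial N := (Submodule.nontrivial_iff_ne_bot).2 hN
  have hgi : Function.Injective g := by
    refine uni_inj_of_comp hu g N.subtype ?_
    have : g.comp N.subtype = N.subtype := by
      ext x
      exact hg x
    rw [this]
    exact N.injective_subtype
  have hgs := IsArtinian.surjective_of_injective_endomorphism g hgi
  have hnt : Nontrivial P := by
    obtain ⟨x, hx⟩ := exists_ne (0 : N)
    exact ⟨x, 0, by simpa using hx⟩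
  apply (rad_isCoatom hu).1
  rw [eq_top_iff]
  rintro y -
  obtain ⟨x, rfl⟩ := hgs y
  exact Subtype.prop _

end Covers2

section Tau

theorem eq_socle_of_isAtom {M : Type u} [AddCommGroup M] [Module Λ M]
    (h : IsUniserialMod Λ M) {A : Submodule Λ M} (hA : IsAtom A) :
    A = modSocle Λ M := by
  apply le_antisymm
  · exact le_sSup hA
  · refine sSup_le ?_
    intro B hB
    rcases h B A with h | h
    · exact h
    · rcases eq_or_lt_of_le h with h | h
      · exact h.ge
      · exact absurd (hB.2 _ h) hA.1

theorem isAtom_range {S M : Type u} [AddCommGroup M] [Module Λ M] [AddCommGroup S] [Module Λ S]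
    (hS : IsSimpleModule Λ S) (j : S →ₗ[Λ] M) (hj : Function.Injective j) :
    IsAtom (LinearMap.range j) := by
  rw [← isSimpleModule_iff_isAtom]
  exact IsSimpleModule.congr (LinearEquiv.ofInjective j hj).symm

theorem isSocleOf_of_inj {S M : Type u} [AddCommGroup M] [Module Λ M] [AddCommGroup S]
    [Module Λ S] (hS : IsSimpleModule Λ S) (h : IsUniserialMod Λ M) (j : S →ₗ[Λ] M)
    (hj : Function.Injective j) : IsSocleOf Λ S M :=
  ⟨j, hj, eq_socle_of_isAtom h (isAtom_range hS j hj)⟩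

theorem socle_isSimple [IsNakayama Λ] {M : Type u} [AddCommGroup M] [Module Λ M]
    [Module.Finite Λ M] [Nontrivial M] (h : IsUniserialMod Λ M) :
    IsSimpleModule Λ (modSocle Λ M) := by
  obtain ⟨A, hA, -⟩ := (IsAtomic.eq_bot_or_exists_atom_le (⊤ : Submodule Λ M)).resolve_left
    top_ne_bot
  rw [← eq_socle_of_isAtom h hA]
  exact isSimpleModule_iff_isAtom.2 hA

theorem isSocleOf_unique {S T M : Type u} [AddCommGroup M] [Module Λ M] [AddCommGroup S]
    [Module Λ S] [AddCommGroup T] [Module Λ T] (h : IsSocleOf Λ S M) (h' : IsSocleOf Λ T M) :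
    Nonempty (S ≃ₗ[Λ] T) := by
  obtain ⟨i, hi, h1⟩ := h
  obtain ⟨j, hj, h2⟩ := h'
  exact ⟨(LinearEquiv.ofInjective i hi).trans ((LinearEquiv.ofEq _ _ (h1.trans h2.symm)).trans
    (LinearEquiv.ofInjective j hj).symm)⟩

/-- Structure of modules of length two with simple top. -/
theorem len_two {L S : Type u} [AddCommGroup L] [Module Λ L] [AddCommGroup S] [Module Λ S]
    (h : HasLength Λ L 2) (ht : IsTopOf Λ S L) :
    IsUniserialMod Λ L ∧ IsAtom (modRadical Λ L) ∧ IsCoatom (modRadical Λ L) := by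
  have hfin := isFiniteLength_iff_isNoetherian_isArtinian.1 (isFiniteLength_of_hasLength h)
  have := hfin.1
  obtain ⟨c, h0, h2, hc⟩ := h
  obtain ⟨hS, p, hp, hk⟩ := ht
  have hco : IsCoatom (modRadical Λ L) := hk ▸ isCoatom_ker p hp
  have huniq : ∀ A : Submodule Λ L, IsCoatom A → A = modRadical Λ L := by
    intro A hA
    have hle : modRadical Λ L ≤ A := sInf_le hA
    rcases eq_or_lt_of_le hle with h | h
    · exact h.symm
    · exact absurd (hco.2 _ h) hA.1
  have hc1 : IsCoatom (c 1) := by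
    have := hc 1
    have e1 : (1 : Fin 2).castSucc = (1 : Fin 3) := rfl
    have e2 : (1 : Fin 2).succ = Fin.last 2 := rfl
    rw [e1, e2, h2] at this
    exact covBy_top_iff.1 this
  have ha1 : IsAtom (c 1) := by
    have := hc 0
    have e1 : (0 : Fin 2).castSucc = (0 : Fin 3) := rfl
    have e2 : (0 : Fin 2).succ = (1 : Fin 3) := rfl
    rw [e1, e2, h0] at this
    exact bot_covBy_iff.1 this
  rw [huniq _ hc1] at ha1
  refine ⟨?_, ha1, hco⟩
  have htri : ∀ A : Submodule Λ L, A = ⊥ ∨ A = ⊤ ∨ A = modRadical Λ L := by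
    intro A
    by_cases hA : A = ⊤
    · exact Or.inr (Or.inl hA)
    obtain ⟨B, hB, hAB⟩ := (IsCoatomic.eq_top_or_exists_le_coatom A).resolve_left hA
    rw [huniq B hB] at hAB
    rcases eq_or_lt_of_le hAB with h | h
    · exact Or.inr (Or.inr h)
    · exact Or.inl (ha1.2 _ h)
  intro A B
  rcases htri A with rfl | rfl | rfl
  · exact Or.inl bot_le
  · exact Or.inr le_top
  · rcases htri B with rfl | rfl | rfl
    · exact Or.inr bot_le
    · exact Or.inl le_top
    · exact Or.inl le_rfl

theorem tau_of {C V T : Type u} [AddCommGroup C] [Module Λ C] [AddCommGroup V] [Module Λ V]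
    [AddCommGroup T] [Module Λ T] (hC : IsUniserialMod Λ C) (hV : IsSimpleModule Λ V)
    (hT : IsSimpleModule Λ T) (v : C →ₗ[Λ] V) (hv : Function.Surjective v)
    (t : LinearMap.ker v →ₗ[Λ] T) (ht : Function.Surjective t) : IsTauOf Λ T V := by
  let A : Submodule Λ C := (LinearMap.ker t).map (LinearMap.ker v).subtype
  have hA : A ≤ LinearMap.ker v := Submodule.map_subtype_le _ _
  have hA' : LinearMap.ker t ≤ A.comap (LinearMap.ker v).subtype := Submodule.le_comap_map _ _
  let w : (C ⧸ A) →ₗ[Λ] V := A.liftQ v hA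
  have hw : Function.Surjective w := by
    intro y
    obtain ⟨x, rfl⟩ := hv y
    exact ⟨Submodule.Quotient.mk x, by simp [w]⟩
  have hL : IsUniserialMod Λ (C ⧸ A) := uni_of_surj A.mkQ A.mkQ_surjective hC
  let i : T →ₗ[Λ] C ⧸ A := ((LinearMap.ker t).mapQ A (LinearMap.ker v).subtype hA').comp
    ((t.quotKerEquivOfSurjective ht).symm : T →ₗ[Λ] _)
  have hi : Function.Injective i := by
    have : Function.Injective ((LinearMap.ker t).mapQ A (LinearMap.ker v).subtype hA') := by
      rw [← LinearMap.ker_eq_bot]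
      simp only [Submodule.mapQ]
      rw [Submodule.ker_liftQ_eq_bot]
      rw [LinearMap.ker_comp, Submodule.ker_mkQ]
      simp only [A]
      rw [Submodule.comap_map_eq_of_injective (Submodule.injective_subtype _)]
    exact this.comp (t.quotKerEquivOfSurjective ht).symm.injective
  have hrange : LinearMap.range i = LinearMap.ker w := by
    apply le_antisymm
    · rintro _ ⟨x, rfl⟩
      obtain ⟨y, rfl⟩ := ht x
      have : (t.quotKerEquivOfSurjective ht).symm (t y) = Submodule.Quotient.mk y := by
        rw [LinearEquiv.symm_apply_eq]
        rfl
      simp [i, this, w]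
    · intro x hx
      obtain ⟨y, rfl⟩ := A.mkQ_surjective x
      have hy : v y = 0 := by simpa [w] using hx
      refine ⟨t ⟨y, hy⟩, ?_⟩
      have : (t.quotKerEquivOfSurjective ht).symm (t ⟨y, hy⟩) =
          Submodule.Quotient.mk ⟨y, hy⟩ := by
        rw [LinearEquiv.symm_apply_eq]
        rfl
      simp [i, this]
  have hat : IsAtom (LinearMap.ker w) := hrange ▸ isAtom_range hT i hi
  have hco : IsCoatom (LinearMap.ker w) := isCoatom_ker w hw
  refine ⟨hV, hT, ModuleCat.of Λ (C ⧸ A), ?_, isTopOf_of_surj hV hL w hw,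
    isSocleOf_of_inj hT hL i hi⟩
  refine ⟨![⊥, LinearMap.ker w, ⊤], rfl, rfl, ?_⟩
  intro k
  fin_cases k
  · exact bot_covBy_iff.2 hat
  · exact covBy_top_iff.2 hco

theorem tau_top [IsNakayama Λ] {P V T : Type u} [AddCommGroup P] [Module Λ P] [AddCommGroup V]
    [Module Λ V] [AddCommGroup T] [Module Λ T] [Module.Finite Λ P] (h : IsTauOf Λ T V)
    (hP : Module.Projective Λ P)
    (hu : IsUniserialMod Λ P) (q : P →ₗ[Λ] V) (hq : Function.Surjective q) :
    IsTopOf Λ T (modRadical Λ P) := by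
  obtain ⟨hV, hT, L, hlen, htop, hsoc⟩ := h
  obtain ⟨hLu, hat, hco⟩ := len_two hlen htop
  obtain ⟨-, p, hp, hpk⟩ := htop
  obtain ⟨j, hj, hjr⟩ := hsoc
  rw [← eq_socle_of_isAtom hLu hat] at hjr
  have : Nontrivial V := IsSimpleModule.nontrivial Λ V
  obtain ⟨g, hg⟩ := Module.projective_lifting_property p q hp
  have hgs : Function.Surjective g := uni_surj_of_comp hLu p g (by rw [hg]; exact hq)
  have hqk : LinearMap.ker q = modRadical Λ P := eq_rad_of_isCoatom hu (isCoatom_ker q hq)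
  have hmem : ∀ x, x ∈ modRadical Λ P ↔ g x ∈ LinearMap.range j := by
    intro x
    rw [hjr, ← hpk, ← hqk, ← hg]
    rfl
  let r : modRadical Λ P →ₗ[Λ] LinearMap.range j := g.restrict (fun x hx => (hmem x).1 hx)
  have hr : Function.Surjective r := by
    rintro ⟨y, hy⟩
    obtain ⟨x, rfl⟩ := hgs y
    exact ⟨⟨x, (hmem x).2 hy⟩, rfl⟩
  exact isTopOf_of_surj hT (uni_sub hu _)
    (((LinearEquiv.ofInjective j hj).symm : _ →ₗ[Λ] T).comp r)
    ((LinearEquiv.ofInjective j hj).symm.surjective.comp hr)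

theorem uni_simple {V : Type u} [AddCommGroup V] [Module Λ V] (hV : IsSimpleModule Λ V) :
    IsUniserialMod Λ V := by
  intro A B
  rcases eq_bot_or_eq_top A with rfl | rfl
  · exact Or.inl bot_le
  · exact Or.inr le_top

theorem tau_unique [IsNakayama Λ] {V T V' T' : Type u} [AddCommGroup V]
    [Module Λ V] [AddCommGroup T] [Module Λ T] [AddCommGroup V']
    [Module Λ V'] [AddCommGroup T'] [Module Λ T'] (h : IsTauOf Λ T V) (h' : IsTauOf Λ T' V')
    (e : V ≃ₗ[Λ] V') : Nonempty (T ≃ₗ[Λ] T') := by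
  have hV : IsSimpleModule Λ V := h.1
  obtain ⟨P, q, hP, hPf, hPu, hq⟩ := exists_cover (uni_simple hV)
  exact isTop_unique (tau_top h hP hPu q hq)
    (tau_top h' hP hPu ((e : V →ₗ[Λ] V').comp q) (e.surjective.comp hq))

/-- `top Ω(M) = τ soc M`. -/
theorem tau_omega {P M V T : Type u} [AddCommGroup P] [Module Λ P] [AddCommGroup M]
    [Module Λ M] [AddCommGroup V] [Module Λ V] [AddCommGroup T] [Module Λ T]
    (hu : IsUniserialMod Λ P) (p : P →ₗ[Λ] M) (hp : Function.Surjective p)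
    (hV : IsSimpleModule Λ V) (hs : IsSocleOf Λ V M) (hT : IsTopOf Λ T (LinearMap.ker p)) :
    IsTauOf Λ T V := by
  obtain ⟨j, hj, -⟩ := hs
  obtain ⟨hT, t, ht, -⟩ := hT
  let C := (LinearMap.range j).comap p
  let v : C →ₗ[Λ] V := ((LinearEquiv.ofInjective j hj).symm : _ →ₗ[Λ] V).comp
    (p.restrict (p := C) (q := LinearMap.range j) (fun x hx => hx))
  have hv : Function.Surjective v := by
    refine (LinearEquiv.ofInjective j hj).symm.surjective.comp ?_
    rintro ⟨y, hy⟩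
    obtain ⟨x, rfl⟩ := hp y
    exact ⟨⟨x, hy⟩, rfl⟩
  have hker : ∀ x : C, v x = 0 ↔ p x = 0 := by
    intro x
    simp only [v, LinearMap.comp_apply, LinearEquiv.coe_coe, LinearEquiv.map_eq_zero_iff]
    rw [Subtype.ext_iff]
    rfl
  let k : LinearMap.ker v →ₗ[Λ] LinearMap.ker p :=
    LinearMap.codRestrict _ (C.subtype.comp (LinearMap.ker v).subtype)
      (fun x => (hker x.1).1 x.2)
  have hk : Function.Surjective k := by
    rintro ⟨y, hy⟩
    have hy0 : p y = 0 := hy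
    have hyC : y ∈ C := by
      change p y ∈ LinearMap.range j
      rw [hy0]
      exact Submodule.zero_mem _
    exact ⟨⟨⟨y, hyC⟩, (hker _).2 hy⟩, rfl⟩
  exact tau_of (uni_sub hu C) hV hT v hv (t.comp k) (ht.comp hk)

theorem gamma_of [IsNakayama Λ] {P X Y Q S T : Type u} [AddCommGroup P] [Module Λ P]
    [AddCommGroup X] [Module Λ X] [AddCommGroup Y] [Module Λ Y] [AddCommGroup Q] [Module Λ Q]
    [AddCommGroup S] [Module Λ S] [AddCommGroup T] [Module Λ T]
    [Module.Finite Λ P] [Nontrivial Y] (hP : Module.Projective Λ P) (hu : IsUniserialMod Λ P)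
    (p : P →ₗ[Λ] X) (hp : Function.Surjective p) (hS : IsTopOf Λ S X)
    (i : Y →ₗ[Λ] P) (hi : Function.Injective i) (hQ : IsUniserialMod Λ Q)
    (q : Q →ₗ[Λ] Y) (hq : Function.Surjective q) (hT : IsTopOf Λ T (LinearMap.ker q)) :
    GammaRel Λ S T := by
  obtain ⟨hS, s, hs, -⟩ := hS
  have hY : IsUniserialMod Λ Y := uni_of_inj i hi hu
  have : Module.Finite Λ Y := Module.Finite.of_injective i hi
  have hV := socle_isSimple hY
  have : Nontrivial S := IsSimpleModule.nontrivial Λ S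
  refine ⟨hS, ModuleCat.of Λ P, s.comp p, isProjCover_of_uni hP hu _ (hs.comp hp),
    ModuleCat.of Λ (modSocle Λ Y), hV, isSocleOf_of_inj hV hu (i.comp (Submodule.subtype _))
      (hi.comp (Submodule.injective_subtype _)), ?_⟩
  exact tau_omega hQ q hq hV (isSocleOf_of_inj hV hY _ (Submodule.injective_subtype _)) hT

theorem gamma_unique [IsNakayama Λ] {S T S' T' : Type u} 
    [AddCommGroup S] [Module Λ S] [AddCommGroup T] [Module Λ T]
    [AddCommGroup S'] [Module Λ S'] [AddCommGroup T'] [Module Λ T']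
    (h : GammaRel Λ S T) (h' : GammaRel Λ S' T') (e : S ≃ₗ[Λ] S') :
    Nonempty (T ≃ₗ[Λ] T') := by
  obtain ⟨hS, P, p, hp, V, hV, hVs, hTV⟩ := h
  obtain ⟨hS', P', p', hp', V', hV', hVs', hTV'⟩ := h'
  obtain ⟨Q, q, hQ, hQf, hQu, hq⟩ := exists_cover (uni_simple hS)
  have : Nontrivial S := IsSimpleModule.nontrivial Λ S
  have : Nontrivial S' := IsSimpleModule.nontrivial Λ S'
  obtain ⟨f, -⟩ := cover_equiv hQ hQu q hq p hp
  obtain ⟨f', -⟩ := cover_equiv hQ hQu ((e : S →ₗ[Λ] S').comp q) (e.surjective.comp hq) p' hp'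
  obtain ⟨j, hj, -⟩ := hVs
  obtain ⟨j', hj', -⟩ := hVs'
  have h1 : IsSocleOf Λ V Q := isSocleOf_of_inj hV hQu ((f : _ →ₗ[Λ] Q).comp j)
    (f.injective.comp hj)
  have h2 : IsSocleOf Λ V' Q := isSocleOf_of_inj hV' hQu ((f' : _ →ₗ[Λ] Q).comp j')
    (f'.injective.comp hj')
  obtain ⟨e'⟩ := isSocleOf_unique h1 h2
  exact tau_unique hTV hTV' e'

theorem gamma_congr {S T S' : Type u} 
    [AddCommGroup S] [Module Λ S] [AddCommGroup T] [Module Λ T]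
    [AddCommGroup S'] [Module Λ S'] 
    (h : GammaRel Λ S T) (e : S ≃ₗ[Λ] S') : GammaRel Λ S' T := by
  obtain ⟨hS, P, p, hp, hrest⟩ := h
  refine ⟨IsSimpleModule.congr e.symm, P, (e : S →ₗ[Λ] S').comp p,
    ⟨hp.1, e.surjective.comp hp.2, ?_⟩, hrest⟩
  rw [LinearEquiv.ker_comp]
  exact hp.3

theorem black_iff [IsNakayama Λ] {P S : Type u} [AddCommGroup P] [Module Λ P]
    [AddCommGroup S] [Module Λ S] [Module.Finite Λ P] (hP : Module.Projective Λ P)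
    (hu : IsUniserialMod Λ P) (hS : IsSimpleModule Λ S) (f : P →ₗ[Λ] S)
    (hf : Function.Surjective f) :
    IsBlackSimple Λ S ↔ ¬ Module.Projective Λ (modRadical Λ P) := by
  have : Nontrivial S := IsSimpleModule.nontrivial Λ S
  rw [← eq_rad_of_isCoatom hu (isCoatom_ker f hf)]
  constructor
  · intro h
    exact h.2 (ModuleCat.of Λ P) f (isProjCover_of_uni hP hu f hf)
  · intro h
    refine ⟨hS, ?_⟩
    intro P' p' hp' hproj
    obtain ⟨e, he⟩ := cover_equiv hP hu f hf p' hp'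
    apply h
    have hmap : (LinearMap.ker p').map (e : P' →ₗ[Λ] P) = LinearMap.ker f := by
      rw [← he, LinearMap.ker_comp, Submodule.map_comap_eq_of_surjective e.surjective]
    rw [← hmap]
    exact Module.Projective.of_equiv (e.submoduleMap (LinearMap.ker p'))

end Tau

section SyzSection

/-- `Y` is the syzygy of `X`, both are nonzero uniserial and the top of `X` is black. -/
def Syz (X Y : Type u) [AddCommGroup X] [Module Λ X] [AddCommGroup Y] [Module Λ Y] : Prop :=
  ∃ (P : ModuleCat.{u} Λ) (p : P →ₗ[Λ] X) (i : Y →ₗ[Λ] P), Module.Projective Λ P ∧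
    Module.Finite Λ P ∧ IsUniserialMod Λ P ∧ Function.Surjective p ∧ Function.Injective i ∧
    LinearMap.range i = LinearMap.ker p ∧ Nontrivial X ∧ Nontrivial Y ∧
    ¬ Module.Projective Λ (modRadical Λ P)

variable {X Y Z : Type u} [AddCommGroup X] [Module Λ X] [AddCommGroup Y] [Module Λ Y]
  [AddCommGroup Z] [Module Λ Z]

theorem Syz.left_uni (h : Syz (Λ := Λ) X Y) :
    IsUniserialMod Λ X ∧ Module.Finite Λ X ∧ Nontrivial X := by
  obtain ⟨P, p, i, hP, hf, hu, hp, hi, hr, hX, hY, hb⟩ := h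
  exact ⟨uni_of_surj p hp hu, Module.Finite.of_surjective p hp, hX⟩

theorem Syz.congr {X' Y' : Type u} [AddCommGroup X'] [Module Λ X'] [AddCommGroup Y']
    [Module Λ Y'] (h : Syz (Λ := Λ) X Y) (e : X ≃ₗ[Λ] X') (f : Y ≃ₗ[Λ] Y') :
    Syz (Λ := Λ) X' Y' := by
  obtain ⟨P, p, i, hP, hf, hu, hp, hi, hr, hX, hY, hb⟩ := h
  refine ⟨P, (e : X →ₗ[Λ] X').comp p, i.comp (f.symm : Y' →ₗ[Λ] Y), hP, hf, hu,
    e.surjective.comp hp, hi.comp f.symm.injective, ?_, e.symm.toEquiv.nontrivial,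
    f.symm.toEquiv.nontrivial, hb⟩
  rw [LinearEquiv.ker_comp, ← hr, LinearEquiv.range_comp]

theorem extend_along [IsNakayama Λ] {P W : Type u} [AddCommGroup P] [Module Λ P]
    [AddCommGroup W] [Module Λ W] [Module.Finite Λ P] [Module.Finite Λ W]
    (hP : Module.Projective Λ P) (hu : IsUniserialMod Λ P)
    (hb : ¬ Module.Projective Λ (modRadical Λ P)) [Nontrivial Y] (i : Y →ₗ[Λ] P)
    (hi : Function.Injective i) (hW : Module.Projective Λ W) (g : Y →ₗ[Λ] W) :
    ∃ h : P →ₗ[Λ] W, h.comp i = g := by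
  have hN : LinearMap.range i ≠ ⊥ := by
    intro h
    rw [LinearMap.range_eq_bot] at h
    obtain ⟨y, hy⟩ := exists_ne (0 : Y)
    exact hy (hi (by simp [h]))
  obtain ⟨h, hh⟩ := extend_of_black hP hu hb (LinearMap.range i) hN W hW
    (g.comp ((LinearEquiv.ofInjective i hi).symm : _ →ₗ[Λ] Y))
  refine ⟨h, ?_⟩
  ext y
  have := LinearMap.congr_fun hh (LinearEquiv.ofInjective i hi y)
  simpa using this

theorem Syz.inj [IsNakayama Λ] {X' Y' : Type u} [AddCommGroup X'] [Module Λ X']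
    [AddCommGroup Y'] [Module Λ Y'] (h : Syz (Λ := Λ) X Y) (h' : Syz (Λ := Λ) X' Y')
    (e : Y ≃ₗ[Λ] Y') : Nonempty (X ≃ₗ[Λ] X') := by
  obtain ⟨P, p, i, hP, hf, hu, hp, hi, hr, hX, hY, hb⟩ := h
  obtain ⟨P', p', i', hP', hf', hu', hp', hi', hr', hX', hY', hb'⟩ :=
    h'.congr (LinearEquiv.refl Λ X') e.symm
  obtain ⟨a, ha⟩ := extend_along hP hu hb i hi hP' i'
  obtain ⟨b, hba⟩ := extend_along hP' hu' hb' i' hi' hP i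
  have hai : Function.Injective a := uni_inj_of_comp hu a i (by rw [ha]; exact hi')
  have hbi : Function.Injective b := uni_inj_of_comp hu' b i' (by rw [hba]; exact hi)
  have hab := IsArtinian.surjective_of_injective_endomorphism (a.comp b) (hai.comp hbi)
  have has : Function.Surjective a := Function.Surjective.of_comp hab
  let E := LinearEquiv.ofBijective a ⟨hai, has⟩
  have hmap : (LinearMap.ker p).map (E : P →ₗ[Λ] P') = LinearMap.ker p' := by
    rw [← hr, ← hr', ← LinearMap.range_comp]
    congr 1
  exact ⟨(p.quotKerEquivOfSurjective hp).symm.trans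
    ((Submodule.Quotient.equiv _ _ E hmap).trans (p'.quotKerEquivOfSurjective hp'))⟩

theorem Syz.gamma [IsNakayama Λ] {S T : Type u} [AddCommGroup S] [Module Λ S]
    [AddCommGroup T] [Module Λ T] (h : Syz (Λ := Λ) X Y) (h' : Syz (Λ := Λ) Y Z)
    (hS : IsTopOf Λ S X) (hT : IsTopOf Λ T Z) : GammaRel Λ S T := by
  obtain ⟨P, p, i, hP, hf, hu, hp, hi, hr, hX, hY, hb⟩ := h
  obtain ⟨P', p', i', hP', hf', hu', hp', hi', hr', hX', hY', hb'⟩ := h'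
  refine gamma_of hP hu p hp hS i hi hu' p' hp' ?_
  obtain ⟨hT, t, ht, -⟩ := hT
  let e : LinearMap.ker p' ≃ₗ[Λ] Z :=
    (LinearEquiv.ofEq _ _ hr'.symm).trans (LinearEquiv.ofInjective i' hi').symm
  exact isTopOf_of_surj hT (uni_sub hu' _) (t.comp (e : _ →ₗ[Λ] Z)) (ht.comp e.surjective)

theorem Syz.black [IsNakayama Λ] {S : Type u} [AddCommGroup S] [Module Λ S]
    (h : Syz (Λ := Λ) X Y) (hS : IsTopOf Λ S X) : IsBlackSimple Λ S := by
  obtain ⟨P, p, i, hP, hf, hu, hp, hi, hr, hX, hY, hb⟩ := h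
  obtain ⟨hS, s, hs, -⟩ := hS
  exact (black_iff hP hu hS (s.comp p) (hs.comp hp)).2 hb

theorem isTopOf_congr {S : Type u} [AddCommGroup S] [Module Λ S] (hY : IsUniserialMod Λ Y)
    (h : IsTopOf Λ S X) (e : X ≃ₗ[Λ] Y) : IsTopOf Λ S Y := by
  obtain ⟨hS, s, hs, -⟩ := h
  exact isTopOf_of_surj hS hY (s.comp (e.symm : Y →ₗ[Λ] X)) (hs.comp e.symm.surjective)

theorem isTopOf_congr_left {S T : Type u} [AddCommGroup S] [Module Λ S] [AddCommGroup T]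
    [Module Λ T] (h : IsTopOf Λ S X) (e : S ≃ₗ[Λ] T) : IsTopOf Λ T X := by
  obtain ⟨hS, s, hs, hk⟩ := h
  refine ⟨IsSimpleModule.congr e.symm, (e : S →ₗ[Λ] T).comp s, e.surjective.comp hs, ?_⟩
  rw [LinearEquiv.ker_comp, hk]

/-- there are finitely many simple modules -/
theorem finite_simples (A : Type u) [AddCommGroup A] [Module Λ A] (hA : IsFiniteLength Λ A) :
    ∃ s : Set (ModuleCat.{u} Λ), s.Finite ∧ ∀ (S : Type u) [AddCommGroup S] [Module Λ S],
      IsSimpleModule Λ S → ∀ f : A →ₗ[Λ] S, f ≠ 0 → ∃ F ∈ s, Nonempty (S ≃ₗ[Λ] F) := by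
  induction hA with
  | of_subsingleton =>
    refine ⟨∅, Set.finite_empty, ?_⟩
    intro S _ _ _ f hf
    exact absurd (Subsingleton.elim _ _) hf
  | @of_simple_quotient M _ _ N hs hN ih =>
    obtain ⟨s, hs, h⟩ := ih
    refine ⟨insert (ModuleCat.of Λ (M ⧸ N)) s, hs.insert _, ?_⟩
    intro S _ _ hS f hf
    by_cases hfN : f.comp N.subtype = 0
    · refine ⟨_, Set.mem_insert _ _, ?_⟩
      have hle : N ≤ LinearMap.ker f := by
        intro x hx
        exact LinearMap.congr_fun hfN ⟨x, hx⟩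
      have hne : N.liftQ f hle ≠ 0 := by
        intro h0
        apply hf
        ext x
        have := LinearMap.congr_fun h0 (Submodule.Quotient.mk x)
        simpa using this
      exact ⟨(LinearEquiv.ofBijective _ (LinearMap.bijective_of_ne_zero hne)).symm⟩
    · obtain ⟨F, hF, e⟩ := h S hS _ hfN
      exact ⟨F, Set.mem_insert_of_mem _ hF, e⟩

theorem inj_of_length_eq [IsNakayama Λ] [Module.Finite Λ X] [Module.Finite Λ Y]
    (f : X →ₗ[Λ] Y) (hf : Function.Surjective f) (h : Module.length Λ X = Module.length Λ Y) :
    Function.Injective f := by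
  by_contra hinj
  have hne : LinearMap.ker f ≠ ⊥ := fun h => hinj (LinearMap.ker_eq_bot.1 h)
  have h1 := Module.length_eq_add_of_exact (LinearMap.ker f).subtype f
    (Submodule.injective_subtype _) hf (LinearMap.exact_subtype_ker_map f)
  have h2 : Module.length Λ (LinearMap.ker f) ≠ 0 := by
    rw [Ne, Module.length_eq_zero_iff]
    intro hs
    exact hne ((Submodule.subsingleton_iff_eq_bot).1 hs)
  have hX := Module.length_ne_top (R := Λ) (M := X)
  have hY := Module.length_ne_top (R := Λ) (M := Y)
  have hK := Module.length_ne_top (R := Λ) (M := LinearMap.ker f)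
  obtain ⟨a, ha⟩ := ENat.ne_top_iff_exists.1 hX
  obtain ⟨b, hb⟩ := ENat.ne_top_iff_exists.1 hY
  obtain ⟨c, hc⟩ := ENat.ne_top_iff_exists.1 hK
  rw [← ha, ← hb, ← hc] at h1
  rw [← ha, ← hb] at h
  rw [← hc] at h2
  norm_cast at h1 h h2
  omega

theorem iso_of_top_length [IsNakayama Λ] [Module.Finite Λ X] [Module.Finite Λ Y]
    (hX : IsUniserialMod Λ X) (hY : IsUniserialMod Λ Y) {S : Type u} [AddCommGroup S]
    [Module Λ S] (hS : IsTopOf Λ S X) (hS' : IsTopOf Λ S Y)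
    (h : Module.length Λ X = Module.length Λ Y) : Nonempty (X ≃ₗ[Λ] Y) := by
  obtain ⟨hSs, s, hs, -⟩ := hS
  obtain ⟨-, s', hs', -⟩ := hS'
  obtain ⟨P, p, hP, hPf, hPu, hp⟩ := exists_cover hX
  have : Nontrivial S := IsSimpleModule.nontrivial Λ S
  obtain ⟨q, hq⟩ := Module.projective_lifting_property s' (s.comp p) hs'
  have hqs : Function.Surjective q :=
    uni_surj_of_comp hY s' q (by rw [hq]; exact hs.comp hp)
  have key : ∀ {A B : Type u} [AddCommGroup A] [Module Λ A] [AddCommGroup B] [Module Λ B]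
      [Module.Finite Λ A] [Module.Finite Λ B] (a : P →ₗ[Λ] A) (b : P →ₗ[Λ] B),
      Function.Surjective a → Function.Surjective b →
      Module.length Λ A = Module.length Λ B → LinearMap.ker a ≤ LinearMap.ker b →
      Nonempty (A ≃ₗ[Λ] B) := by
    intro A B _ _ _ _ _ _ a b ha hb hl hk
    let g : A →ₗ[Λ] B := ((LinearMap.ker a).liftQ b hk).comp
      ((a.quotKerEquivOfSurjective ha).symm : A →ₗ[Λ] _)
    have hg : Function.Surjective g := by
      intro y
      obtain ⟨x, rfl⟩ := hb y
      refine ⟨a x, ?_⟩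
      have h3 : (a.quotKerEquivOfSurjective ha).symm (a x) = Submodule.Quotient.mk x := by
        rw [LinearEquiv.symm_apply_eq]
        rfl
      simp [g, h3]
    exact ⟨LinearEquiv.ofBijective g ⟨inj_of_length_eq g hg hl, hg⟩⟩
  rcases hPu (LinearMap.ker p) (LinearMap.ker q) with hk | hk
  · exact key p q hp hqs h hk
  · obtain ⟨e⟩ := key q p hqs hp h.symm hk
    exact ⟨e.symm⟩

theorem length_le_ring [IsNakayama Λ] [Module.Finite Λ X] [Nontrivial X]
    (hX : IsUniserialMod Λ X) : Module.length Λ X ≤ Module.length Λ Λ := by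
  have hco := rad_isCoatom hX
  obtain ⟨x, hx⟩ : ∃ x, x ∉ modRadical Λ X := by
    by_contra! hcon
    exact hco.1 (eq_top_iff.2 fun y _ => hcon y)
  refine Module.length_le_of_surjective (LinearMap.toSpanSingleton Λ X x) ?_
  rw [← LinearMap.range_eq_top]
  by_contra hne
  exact hx (le_rad hX hne ⟨1, by simp⟩)

theorem exists_period [IsNakayama Λ] (X : ℕ → ModuleCat.{u} Λ)
    (h : ∀ i, Syz (Λ := Λ) (X i) (X (i + 1))) :
    ∃ m, 0 < m ∧ Nonempty (X 0 ≃ₗ[Λ] X (2 * m)) := by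
  obtain ⟨s, hsf, hs⟩ := finite_simples (Λ := Λ) Λ
    (isFiniteLength_iff_isNoetherian_isArtinian.2 ⟨inferInstance, inferInstance⟩)
  obtain ⟨L, hL⟩ := ENat.ne_top_iff_exists.1 (Module.length_ne_top (R := Λ) (M := Λ))
  have hdata : ∀ i, ∃ t : s × Fin (L + 1), IsTopOf Λ (t.1 : ModuleCat.{u} Λ) (X i) ∧
      Module.length Λ (X i) = (t.2 : ℕ) := by
    intro i
    obtain ⟨hu, hf, hn⟩ := (h i).left_uni
    have htop := exists_top hu
    have hsimp := htop.1
    have : Nontrivial (X i ⧸ modRadical Λ (X i)) := IsSimpleModule.nontrivial Λ _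
    obtain ⟨y, hy⟩ := exists_ne (0 : X i ⧸ modRadical Λ (X i))
    obtain ⟨F, hF, ⟨e⟩⟩ := hs _ hsimp (LinearMap.toSpanSingleton Λ _ y) (by
      intro h0
      have := LinearMap.congr_fun h0 1
      simp at this
      exact hy this)
    obtain ⟨l, hl⟩ := ENat.ne_top_iff_exists.1 (Module.length_ne_top (R := Λ) (M := X i))
    have hle := length_le_ring hu
    rw [← hl, ← hL] at hle
    refine ⟨(⟨F, hF⟩, ⟨l, by have : l ≤ L := by exact_mod_cast hle
                             omega⟩), isTopOf_congr_left htop e, hl.symm⟩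
  choose t ht1 ht2 using hdata
  have := hsf.to_subtype
  obtain ⟨a, b, hab, heq⟩ := Finite.exists_ne_map_eq_of_infinite (fun i => t (2 * i))
  have hiso : ∀ a b, t a = t b → Nonempty (X a ≃ₗ[Λ] X b) := by
    intro a b hab
    obtain ⟨hu, hf, hn⟩ := (h a).left_uni
    obtain ⟨hu', hf', hn'⟩ := (h b).left_uni
    have h1 := ht1 b
    have h2 := ht2 b
    rw [← hab] at h1 h2
    exact iso_of_top_length hu hu' (ht1 a) h1 ((ht2 a).trans h2.symm)
  have hdesc : ∀ k a, Nonempty (X a ≃ₗ[Λ] X (a + k)) → Nonempty (X 0 ≃ₗ[Λ] X k) := by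
    intro k a
    induction a with
    | zero => intro h; rwa [Nat.zero_add] at h
    | succ a ih =>
      rintro ⟨e⟩
      apply ih
      have h2 := h (a + k)
      rw [show a + k + 1 = a + 1 + k by omega] at h2
      exact (h a).inj h2 e
  have hfin : ∀ a b, a < b → t (2 * a) = t (2 * b) →
      ∃ m, 0 < m ∧ Nonempty (X 0 ≃ₗ[Λ] X (2 * m)) := by
    intro a b hlt he
    refine ⟨b - a, by omega, hdesc _ (2 * a) ?_⟩
    rw [show 2 * a + 2 * (b - a) = 2 * b by omega]
    exact hiso _ _ he
  rcases lt_or_gt_of_ne hab with hlt | hlt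
  · exact hfin a b hlt heq
  · exact hfin b a hlt heq.symm

theorem gp_of_chain [IsNakayama Λ] (W : ℤ → ModuleCat.{u} Λ)
    (h : ∀ i, Syz (Λ := Λ) (W (i - 1)) (W i)) : IsGorensteinProjective Λ (W 0) := by
  choose P p ι hP hfin hu hp hι hr hX hY hb using h
  have he : ∀ i : ℤ, Nonempty (W (i + 1 - 1) ≃ₗ[Λ] W i) := by
    intro i
    rw [add_sub_cancel_right]
    exact ⟨LinearEquiv.refl _ _⟩
  have e : ∀ i : ℤ, W (i + 1 - 1) ≃ₗ[Λ] W i := fun i => Classical.choice (he i)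
  let d : ∀ i, P (i + 1) →ₗ[Λ] P i := fun i =>
    (ι i).comp ((e i : _ →ₗ[Λ] W i).comp (p (i + 1)))
  have hrange : ∀ i, LinearMap.range (d i) = LinearMap.range (ι i) := by
    intro i
    apply le_antisymm
    · rintro _ ⟨x, rfl⟩
      exact ⟨_, rfl⟩
    · rintro _ ⟨x, rfl⟩
      obtain ⟨y, hy⟩ := hp (i + 1) ((e i).symm x)
      exact ⟨y, by simp [d, hy]⟩
  have hker : ∀ i, LinearMap.ker (d i) = LinearMap.ker (p (i + 1)) := by
    intro i
    ext x
    simp only [d, LinearMap.mem_ker, LinearMap.comp_apply]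
    rw [map_eq_zero_iff _ (hι i)]
    simp
  refine ⟨P, d, hP, ?_, ?_, ?_⟩
  · intro i
    rw [LinearMap.exact_iff, hrange, hker, hr]
  · intro i φ hφ
    have hle : LinearMap.ker (p (i + 1)) ≤ LinearMap.ker φ := by
      rw [← hr, ← hrange]
      rintro _ ⟨x, rfl⟩
      exact LinearMap.congr_fun hφ x
    let φ' : W i →ₗ[Λ] Λ := ((LinearMap.ker (p (i + 1))).liftQ φ hle).comp
      ((((p (i + 1)).quotKerEquivOfSurjective (hp (i + 1))).symm : W (i + 1 - 1) →ₗ[Λ] _).comp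
        ((e i).symm : W i →ₗ[Λ] W (i + 1 - 1)))
    have := hfin i
    have := hY i
    obtain ⟨ψ, hψ⟩ := extend_along (hP i) (hu i) (hb i) (ι i) (hι i)
      (inferInstance : Module.Projective Λ Λ) φ'
    refine ⟨ψ, ?_⟩
    ext x
    have h1 := LinearMap.congr_fun hψ (e i (p (i + 1) x))
    have h2 : ((p (i + 1)).quotKerEquivOfSurjective (hp (i + 1))).symm (p (i + 1) x) =
        Submodule.Quotient.mk x := by
      rw [LinearEquiv.symm_apply_eq]
      rfl
    simpa [φ', h2, d] using h1
  · exact ⟨(LinearEquiv.ofInjective (ι 0) (hι 0)).trans (LinearEquiv.ofEq _ _ (hrange 0).symm)⟩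

theorem gp_congr {M N : Type u} [AddCommGroup M] [Module Λ M] [AddCommGroup N] [Module Λ N]
    (h : IsGorensteinProjective Λ M) (e : M ≃ₗ[Λ] N) : IsGorensteinProjective Λ N := by
  obtain ⟨P, d, h1, h2, h3, ⟨f⟩⟩ := h
  exact ⟨P, d, h1, h2, h3, ⟨e.symm.trans f⟩⟩

theorem gp_of_seq [IsNakayama Λ] (X : ℕ → ModuleCat.{u} Λ)
    (h : ∀ i, Syz (Λ := Λ) (X i) (X (i + 1))) : IsGorensteinProjective Λ (X 0) := by
  obtain ⟨m, hm, ⟨e⟩⟩ := exists_period X h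
  obtain ⟨W, hW⟩ : ∃ W : ℤ → ModuleCat.{u} Λ,
      ∀ i, W i = X (i % ((2 * m : ℕ) : ℤ)).toNat := ⟨_, fun _ => rfl⟩
  have hW0 : Nonempty (W 0 ≃ₗ[Λ] X 0) := by
    have : W 0 = X 0 := by
      rw [hW]
      simp
    rw [this]
    exact ⟨LinearEquiv.refl _ _⟩
  obtain ⟨e0⟩ := hW0
  refine gp_congr (gp_of_chain (Λ := Λ) W ?_) e0
  · intro i
    rw [hW, hW]
    have hn : (0 : ℤ) < (2 * m : ℕ) := by omega
    set n : ℕ := 2 * m with hnm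
    have hr0 := Int.emod_nonneg (i - 1) hn.ne'
    have hr1 := Int.emod_lt_of_pos (i - 1) hn
    have hi : i % n = ((i - 1) % n + 1) % n := by
      rw [Int.emod_add_emod]
      congr 1
      omega
    obtain ⟨r, hr⟩ := Int.eq_ofNat_of_zero_le hr0
    rw [hi, hr, Int.toNat_natCast]
    rw [hr] at hr1
    have hrn : r < n := by exact_mod_cast hr1
    by_cases hlast : r + 1 = n
    · have e1 : (((r : ℤ) + 1) % (n : ℤ)).toNat = 0 := by
        have : ((r : ℤ) + 1) = (n : ℤ) := by exact_mod_cast hlast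
        rw [this]
        simp
      rw [e1]
      have hs := h r
      rw [hlast] at hs
      exact hs.congr (LinearEquiv.refl _ _) e.symm
    · have e1 : (((r : ℤ) + 1) % (n : ℤ)).toNat = r + 1 := by
        rw [Int.emod_eq_of_lt (by omega) (by omega)]
        omega
      rw [e1]
      exact h r

theorem cb_congr {S T : Type u} [AddCommGroup S] [Module Λ S] [AddCommGroup T]
    [Module Λ T] (h : IsCyclicallyBlack Λ S) (e : S ≃ₗ[Λ] T) : IsCyclicallyBlack Λ T := by
  obtain ⟨n, C, hn, ⟨e0⟩, ⟨e1⟩, h1, h2⟩ := h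
  exact ⟨n, C, hn, ⟨e0.trans e⟩, ⟨e1.trans e⟩, h1, h2⟩

theorem black_congr {S T : Type u} [AddCommGroup S] [Module Λ S] [AddCommGroup T]
    [Module Λ T] (h : IsBlackSimple Λ S) (e : S ≃ₗ[Λ] T) : IsBlackSimple Λ T := by
  have := h.1
  refine ⟨IsSimpleModule.congr e.symm, ?_⟩
  intro P p hp
  have hk : LinearMap.ker ((e.symm : T →ₗ[Λ] S).comp p) = LinearMap.ker p :=
    LinearEquiv.ker_comp _ _
  have := h.2 P ((e.symm : T →ₗ[Λ] S).comp p)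
    ⟨hp.1, e.symm.surjective.comp hp.2, by rw [hk]; exact hp.3⟩
  rwa [hk] at this

theorem cb_black {S : Type u} [AddCommGroup S] [Module Λ S] (h : IsCyclicallyBlack Λ S) :
    IsBlackSimple Λ S := by
  obtain ⟨n, C, hn, ⟨e0⟩, ⟨e1⟩, h1, h2⟩ := h
  exact black_congr (h2 0 (Nat.zero_le _)) e0

theorem cb_next [IsNakayama Λ] {S T : Type u} [AddCommGroup S] [Module Λ S] [AddCommGroup T]
    [Module Λ T] (h : IsCyclicallyBlack Λ S) (hg : GammaRel Λ S T) : IsCyclicallyBlack Λ T := by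
  obtain ⟨n, C, hn, ⟨e0⟩, ⟨e1⟩, h1, h2⟩ := h
  obtain ⟨f⟩ := gamma_unique (h1 0 hn) hg e0
  obtain ⟨D, hD1, hD2⟩ : ∃ D : ℕ → ModuleCat.{u} Λ, (∀ i < n, D i = C (i + 1)) ∧ D n = C 1 :=
    ⟨fun i => if i < n then C (i + 1) else C 1, by intro i hi; simp [hi], by simp⟩
  refine ⟨n, D, hn, ?_, ?_, ?_, ?_⟩
  · rw [hD1 0 hn]
    exact ⟨f⟩
  · rw [hD2]
    exact ⟨f⟩
  · intro i hi
    rw [hD1 i hi]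
    by_cases hi' : i + 1 < n
    · rw [hD1 _ hi']
      exact h1 _ hi'
    · have : i + 1 = n := by omega
      rw [this, hD2]
      exact gamma_congr (h1 0 hn) (e0.trans e1.symm)
  · intro i hi
    by_cases hi' : i < n
    · rw [hD1 i hi']
      exact h2 _ hi'
    · have : i = n := by omega
      rw [this, hD2]
      exact h2 1 hn

theorem cb_of_seq [IsNakayama Λ] (X : ℕ → ModuleCat.{u} Λ)
    (h : ∀ i, Syz (Λ := Λ) (X i) (X (i + 1))) {S : Type u} [AddCommGroup S] [Module Λ S]
    (hS : IsTopOf Λ S (X 0)) : IsCyclicallyBlack Λ S := by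
  obtain ⟨m, hm, ⟨e⟩⟩ := exists_period X h
  have htop : ∀ i, IsTopOf Λ (X i ⧸ modRadical Λ (X i)) (X i) := by
    intro i
    obtain ⟨hu, hf, hn⟩ := (h i).left_uni
    exact exists_top hu
  refine ⟨m, fun i => ModuleCat.of Λ (X (2 * i) ⧸ modRadical Λ (X (2 * i))), hm, ?_, ?_, ?_, ?_⟩
  · exact isTop_unique (htop 0) hS
  · exact isTop_unique (htop (2 * m)) (isTopOf_congr (h (2 * m)).left_uni.1 hS e)
  · intro i _
    exact (h (2 * i)).gamma (h (2 * i + 1)) (htop _) (htop _)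
  · intro i _
    exact (h (2 * i)).black (htop _)

theorem exists_seq_of (G : ModuleCat.{u} Λ → Prop)
    (hG : ∀ X, G X → ∃ Y : ModuleCat.{u} Λ, Syz (Λ := Λ) X Y ∧ G Y) (X₀ : ModuleCat.{u} Λ)
    (h₀ : G X₀) :
    ∃ X : ℕ → ModuleCat.{u} Λ, X 0 = X₀ ∧ ∀ i, Syz (Λ := Λ) (X i) (X (i + 1)) := by
  choose f hf hf' using hG
  let F : ℕ → {X : ModuleCat.{u} Λ // G X} := fun n =>
    Nat.rec ⟨X₀, h₀⟩ (fun _ Z => ⟨f Z.1 Z.2, hf' Z.1 Z.2⟩) n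
  exact ⟨fun n => (F n).1, rfl, fun i => hf (F i).1 (F i).2⟩

theorem syz_ker {P X : Type u} [AddCommGroup P] [Module Λ P] [AddCommGroup X] [Module Λ X]
    [Module.Finite Λ P] [Nontrivial X] (hP : Module.Projective Λ P) (hu : IsUniserialMod Λ P)
    (hb : ¬ Module.Projective Λ (modRadical Λ P)) (p : P →ₗ[Λ] X)
    (hp : Function.Surjective p) (hk : LinearMap.ker p ≠ ⊥) :
    Syz (Λ := Λ) X (LinearMap.ker p) :=
  ⟨ModuleCat.of Λ P, p, (LinearMap.ker p).subtype, hP, ‹_›, hu, hp,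
    Submodule.injective_subtype _, Submodule.range_subtype _, ‹_›,
    Submodule.nontrivial_iff_ne_bot.2 hk, hb⟩

theorem ker_ne_top {P X : Type u} [AddCommGroup P] [Module Λ P] [AddCommGroup X] [Module Λ X]
    [Nontrivial X] (p : P →ₗ[Λ] X) (hp : Function.Surjective p) : LinearMap.ker p ≠ ⊤ := by
  intro h
  rw [LinearMap.ker_eq_top] at h
  obtain ⟨y, hy⟩ := exists_ne (0 : X)
  obtain ⟨x, hx⟩ := hp y
  exact hy (by rw [← hx, h]; rfl)

theorem ker_ne_bot {P X : Type u} [AddCommGroup P] [Module Λ P] [AddCommGroup X] [Module Λ X]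
    (hP : Module.Projective Λ P) (hX : ¬ Module.Projective Λ X)
    (p : P →ₗ[Λ] X) (hp : Function.Surjective p) : LinearMap.ker p ≠ ⊥ := by
  intro h
  exact hX (Module.Projective.of_equiv
    (LinearEquiv.ofBijective p ⟨LinearMap.ker_eq_bot.1 h, hp⟩))

theorem seq_of_cb [IsNakayama Λ] (M : Type u) [AddCommGroup M] [Module Λ M]
    [Module.Finite Λ M] [Nontrivial M] (hu : IsUniserialMod Λ M)
    (hnp : ¬ Module.Projective Λ M)
    (h1 : ∀ (S : Type u) [AddCommGroup S] [Module Λ S], IsTopOf Λ S M → IsCyclicallyBlack Λ S)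
    (h2 : ∀ (P : ModuleCat.{u} Λ) (p : P →ₗ[Λ] M), IsProjCover p →
        ∀ (T : Type u) [AddCommGroup T] [Module Λ T],
          IsTopOf Λ T (LinearMap.ker p) → IsCyclicallyBlack Λ T) :
    ∃ X : ℕ → ModuleCat.{u} Λ, X 0 = ModuleCat.of Λ M ∧
      ∀ i, Syz (Λ := Λ) (X i) (X (i + 1)) := by
  refine exists_seq_of (fun X => Module.Finite Λ X ∧ Nontrivial X ∧ IsUniserialMod Λ X ∧
    ¬ Module.Projective Λ X ∧ (∀ (S : Type u) [AddCommGroup S] [Module Λ S],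
      IsTopOf Λ S X → IsCyclicallyBlack Λ S) ∧
    ∀ (P : ModuleCat.{u} Λ) (p : P →ₗ[Λ] X), Module.Projective Λ P → Module.Finite Λ P →
      IsUniserialMod Λ P → Function.Surjective p →
        ∀ (T : Type u) [AddCommGroup T] [Module Λ T],
          IsTopOf Λ T (LinearMap.ker p) → IsCyclicallyBlack Λ T) ?_ (ModuleCat.of Λ M) ?_
  · rintro X ⟨hf, hn, hu, hnp, h1, h2⟩
    obtain ⟨P, p, hP, hPf, hPu, hp⟩ := exists_cover hu
    have hkb := ker_ne_bot hP hnp p hp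
    have hkt := ker_ne_top p hp
    have htop := exists_top hu
    have hcb := h1 _ htop
    obtain ⟨hs, s, hss, -⟩ := id htop
    have hb := (black_iff hP hPu hs (s.comp p) (hss.comp hp)).1 (cb_black hcb)
    have hkn : Nontrivial (LinearMap.ker p) := Submodule.nontrivial_iff_ne_bot.2 hkb
    refine ⟨ModuleCat.of Λ (LinearMap.ker p), syz_ker hP hPu hb p hp hkb, ?_, hkn,
      uni_sub hPu _, ?_, ?_, ?_⟩
    · change Module.Finite Λ (LinearMap.ker p)
      infer_instance
    · exact fun hpr => hb (proj_rad_of_sub hPu _ hkb hkt hpr)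
    · intro T _ _ hT
      exact h2 P p hP hPf hPu hp T hT
    · intro Q q hQ hQf hQu hq T _ _ hT
      exact cb_next hcb (gamma_of hP hPu p hp htop (LinearMap.ker p).subtype
        (Submodule.injective_subtype _) hQu q hq hT)
  · refine ⟨‹_›, ‹_›, hu, hnp, h1, ?_⟩
    intro P p hP hPf hPu hp T _ _ hT
    exact h2 P p (isProjCover_of_uni hP hPu p hp) T hT

theorem seq_of_gp [IsNakayama Λ] (M : Type u) [AddCommGroup M] [Module Λ M]
    [Module.Finite Λ M] [Nontrivial M] (hu : IsUniserialMod Λ M)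
    (hnp : ¬ Module.Projective Λ M) (h : IsGorensteinProjective Λ M) :
    ∃ X : ℕ → ModuleCat.{u} Λ, X 0 = ModuleCat.of Λ M ∧
      ∀ i, Syz (Λ := Λ) (X i) (X (i + 1)) := by
  obtain ⟨B, d, hB, hex, hhom, ⟨e⟩⟩ := h
  refine exists_seq_of (fun X => Module.Finite Λ X ∧ Nontrivial X ∧ IsUniserialMod Λ X ∧
    ¬ Module.Projective Λ X ∧ ∃ (k : ℤ) (i : X →ₗ[Λ] LinearMap.range (d k))
      (r : LinearMap.range (d k) →ₗ[Λ] X), r.comp i = LinearMap.id) ?_ (ModuleCat.of Λ M) ?_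
  · rintro X ⟨hf, hn, hu, hnp, k, i, r, hri⟩
    obtain ⟨P, p, hP, hPf, hPu, hp⟩ := exists_cover hu
    have hkb := ker_ne_bot hP hnp p hp
    have hkt := ker_ne_top p hp
    have hkn : Nontrivial (LinearMap.ker p) := Submodule.nontrivial_iff_ne_bot.2 hkb
    let ε := (d k).rangeRestrict
    have hε : Function.Surjective ε := (d k).surjective_rangeRestrict
    have hBk := hB (k + 1)
    obtain ⟨f, hf1⟩ := Module.projective_lifting_property p (r.comp ε) hp
    obtain ⟨s, hs⟩ := Module.projective_lifting_property ε (i.comp p) hε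
    have hpfs : p.comp (f.comp s) = p := by
      rw [← LinearMap.comp_assoc, hf1, LinearMap.comp_assoc, hs, ← LinearMap.comp_assoc, hri,
        LinearMap.id_comp]
    have hfs : Function.Surjective (f.comp s) :=
      uni_surj_of_comp hPu p _ (by rw [hpfs]; exact hp)
    have hfi := IsNoetherian.injective_of_surjective_endomorphism _ hfs
    let E := LinearEquiv.ofBijective (f.comp s) ⟨hfi, hfs⟩
    have hE : ∀ x, E x = f (s x) := fun x => rfl
    have hpE : ∀ x, p (E.symm x) = p x := by
      intro x
      have := LinearMap.congr_fun hpfs (E.symm x)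
      rw [← this]
      change p (E (E.symm x)) = p x
      rw [E.apply_symm_apply]
    let f' : B (k + 1) →ₗ[Λ] P := (E.symm : P →ₗ[Λ] P).comp f
    have hf's : ∀ x, f' (s x) = x := by
      intro x
      change E.symm (f (s x)) = x
      rw [← hE, E.symm_apply_apply]
    have hpf' : ∀ x, p (f' x) = r (ε x) := by
      intro x
      change p (E.symm (f x)) = _
      rw [hpE]
      exact LinearMap.congr_fun hf1 x
    have hεs : ∀ x, ε (s x) = i (p x) := fun x => LinearMap.congr_fun hs x
    have hrange : LinearMap.ker (d k) = LinearMap.range (d (k + 1)) :=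
      LinearMap.exact_iff.1 (hex k)
    have hmem1 : ∀ y ∈ LinearMap.range (d (k + 1)), f' y ∈ LinearMap.ker p := by
      intro y hy
      rw [← hrange] at hy
      have h0 : ε y = 0 := Subtype.ext hy
      rw [LinearMap.mem_ker, hpf', h0, map_zero]
    have hmem2 : ∀ x ∈ LinearMap.ker p, s x ∈ LinearMap.range (d (k + 1)) := by
      intro x hx
      rw [← hrange]
      have h0 : ε (s x) = 0 := by
        rw [hεs, LinearMap.mem_ker.1 hx, map_zero]
      exact congrArg Subtype.val h0
    let i' : LinearMap.ker p →ₗ[Λ] LinearMap.range (d (k + 1)) := s.restrict hmem2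
    let r' : LinearMap.range (d (k + 1)) →ₗ[Λ] LinearMap.ker p := f'.restrict hmem1
    have hb : ¬ Module.Projective Λ (modRadical Λ P) := by
      refine black_of_extend hPu _ hkb hkt ?_
      intro φ
      have hz0 : ((φ.comp r').comp (d (k + 1)).rangeRestrict).comp (d (k + 1 + 1)) = 0 := by
        apply LinearMap.ext
        intro x
        have h0 : (d (k + 1)).rangeRestrict (d (k + 1 + 1) x) = 0 :=
          Subtype.ext ((hex (k + 1)).apply_apply_eq_zero x)
        change φ (r' ((d (k + 1)).rangeRestrict (d (k + 1 + 1) x))) = 0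
        rw [h0, map_zero, map_zero]
      obtain ⟨ψ, hψ⟩ := hhom (k + 1) _ hz0
      refine ⟨ψ.comp s, ?_⟩
      apply LinearMap.ext
      intro x
      obtain ⟨z, hz⟩ := hmem2 x x.2
      have h1 := LinearMap.congr_fun hψ z
      change ψ (d (k + 1) z) = φ (r' ((d (k + 1)).rangeRestrict z)) at h1
      change ψ (s x) = φ x
      rw [← hz, h1]
      congr 1
      apply Subtype.ext
      change f' (d (k + 1) z) = x
      rw [hz, hf's]
    refine ⟨ModuleCat.of Λ (LinearMap.ker p), syz_ker hP hPu hb p hp hkb, ?_, hkn,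
      uni_sub hPu _, ?_, k + 1, i', r', ?_⟩
    · change Module.Finite Λ (LinearMap.ker p)
      infer_instance
    · exact fun hpr => hb (proj_rad_of_sub hPu _ hkb hkt hpr)
    · ext x
      exact hf's x
  · exact ⟨‹_›, ‹_›, hu, hnp, 0, (e : M →ₗ[Λ] _), (e.symm : _ →ₗ[Λ] M), by ext; simp⟩

end SyzSection

theorem cond_iff [IsNakayama Λ] (M : Type u) [AddCommGroup M] [Module Λ M]
    [Module.Finite Λ M] [Nontrivial M] (hu : IsUniserialMod Λ M)
    (hnp : ¬ Module.Projective Λ M) :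
    (∀ (P : ModuleCat.{u} Λ) (p : P →ₗ[Λ] M), IsProjCover p →
        ∀ (T : Type u) [AddCommGroup T] [Module Λ T],
          IsTopOf Λ T (LinearMap.ker p) → IsCyclicallyBlack Λ T) ↔
    (∀ (V T : Type u) [AddCommGroup V] [Module Λ V] [AddCommGroup T] [Module Λ T],
        IsSimpleModule Λ V → IsSocleOf Λ V M → IsTauOf Λ T V →
          IsCyclicallyBlack Λ T) := by
  obtain ⟨P, p, hP, hPf, hPu, hp⟩ := exists_cover hu
  constructor
  · intro h V T _ _ _ _ hV hVs hT
    have hkb := ker_ne_bot hP hnp p hp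
    have hkn : Nontrivial (LinearMap.ker p) := Submodule.nontrivial_iff_ne_bot.2 hkb
    have htop := exists_top (uni_sub hPu (LinearMap.ker p))
    obtain ⟨e⟩ := tau_unique (tau_omega hPu p hp hV hVs htop) hT (LinearEquiv.refl Λ V)
    exact cb_congr (h P p (isProjCover_of_uni hP hPu p hp) _ htop) e
  · intro h Q q hq T _ _ hT
    obtain ⟨e, he⟩ := cover_equiv hP hPu p hp q hq
    have hQu : IsUniserialMod Λ Q := uni_of_inj (e : Q →ₗ[Λ] P) e.injective hPu
    have hV := socle_isSimple hu
    have hVs : IsSocleOf Λ (modSocle Λ M) M :=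
      isSocleOf_of_inj hV hu (modSocle Λ M).subtype (Submodule.injective_subtype _)
    exact h _ T hV hVs (tau_omega hQu q hq.2 hV hVs hT)

theorem gp_imp [IsNakayama Λ] (X : ℕ → ModuleCat.{u} Λ)
    (h : ∀ i, Syz (Λ := Λ) (X i) (X (i + 1))) (Q : ModuleCat.{u} Λ) (q : Q →ₗ[Λ] X 0)
    (hq : IsProjCover q) (T : Type u) [AddCommGroup T] [Module Λ T]
    (hT : IsTopOf Λ T (LinearMap.ker q)) : IsCyclicallyBlack Λ T := by
  obtain ⟨P, p, i, hP, hf, hu, hp, hi, hr, hX, hY, hb⟩ := h 0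
  obtain ⟨e, he⟩ := cover_equiv hP hu p hp q hq
  refine cb_of_seq (fun i => X (i + 1)) (fun i => h (i + 1)) ?_
  have hk : (LinearMap.ker q).map (e : Q →ₗ[Λ] P) = LinearMap.ker p := by
    rw [← he, LinearMap.ker_comp]
    exact Submodule.map_comap_eq_of_surjective e.surjective _
  let f : LinearMap.ker q ≃ₗ[Λ] X 1 :=
    (e.submoduleMap (LinearMap.ker q)).trans
      ((LinearEquiv.ofEq _ _ (hk.trans hr.symm)).trans (LinearEquiv.ofInjective i hi).symm)
  exact isTopOf_congr (h 1).left_uni.1 hT f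

theorem gp_iff [IsNakayama Λ] (M : Type u) [AddCommGroup M] [Module Λ M]
    [Module.Finite Λ M] [Nontrivial M] (hu : IsUniserialMod Λ M)
    (hnp : ¬ Module.Projective Λ M) :
    IsGorensteinProjective Λ M ↔
      (∀ (S : Type u) [AddCommGroup S] [Module Λ S], IsTopOf Λ S M →
        IsCyclicallyBlack Λ S) ∧
      ∀ (P : ModuleCat.{u} Λ) (p : P →ₗ[Λ] M), IsProjCover p →
        ∀ (T : Type u) [AddCommGroup T] [Module Λ T],
          IsTopOf Λ T (LinearMap.ker p) → IsCyclicallyBlack Λ T := by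
  constructor
  · intro h
    obtain ⟨X, hX0, hX⟩ := seq_of_gp M hu hnp h
    have h1 : ∀ (S : Type u) [AddCommGroup S] [Module Λ S], IsTopOf Λ S (X 0) →
        IsCyclicallyBlack Λ S := fun S _ _ hS => cb_of_seq X hX hS
    have h2 := gp_imp X hX
    rw [hX0] at h1 h2
    exact ⟨h1, h2⟩
  · rintro ⟨h1, h2⟩
    obtain ⟨X, hX0, hX⟩ := seq_of_cb M hu hnp h1 h2
    have h3 := gp_of_seq X hX
    rw [hX0] at h3
    exact h3

end Helpers

/-- Let `Λ` be a Nakayama algebra without simple projectives and `M` indecomposable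
non-projective of finite length. Then `M` is Gorenstein projective iff both `top M` and
`top Ω(M)` are cyclically black in the resolution quiver, iff both `top M` and `τ soc M`
are cyclically black. -/
theorem gorenstein_projective_iff_cyclically_black [IsNakayama Λ]
    (h0 : NoSimpleProjectives Λ)
    (M : Type u) [AddCommGroup M] [Module Λ M]
    (hfl : ∃ n, HasLength Λ M n) (hind : IsIndecomposableMod Λ M)
    (hnp : ¬ Module.Projective Λ M) :
    (IsGorensteinProjective Λ M ↔
      (∀ (S : Type u) [AddCommGroup S] [Module Λ S], IsTopOf Λ S M →
        IsCyclicallyBlack Λ S) ∧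
      ∀ (P : ModuleCat.{u} Λ) (p : P →ₗ[Λ] M), IsProjCover p →
        ∀ (T : Type u) [AddCommGroup T] [Module Λ T],
          IsTopOf Λ T (LinearMap.ker p) → IsCyclicallyBlack Λ T) ∧
    (IsGorensteinProjective Λ M ↔
      (∀ (S : Type u) [AddCommGroup S] [Module Λ S], IsTopOf Λ S M →
        IsCyclicallyBlack Λ S) ∧
      ∀ (V T : Type u) [AddCommGroup V] [Module Λ V] [AddCommGroup T] [Module Λ T],
        IsSimpleModule Λ V → IsSocleOf Λ V M → IsTauOf Λ T V →
          IsCyclicallyBlack Λ T) := by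
  have hf : Module.Finite Λ M := finite_of_hasLength hfl.choose_spec
  have hn : Nontrivial M := hind.1
  have hu : IsUniserialMod Λ M := IsNakayama.serial M hfl hind
  have h1 := gp_iff M hu hnp
  refine ⟨h1, h1.trans (and_congr_right' (cond_iff M hu hnp))⟩
end
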